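/- Let P be a simple polygon in the plane with vertices v_0, …, v_{n-1} in counterclockwise order (indices mod n), with no three distinct vertices collinear. Let i be an index and j = i + k (mod n) with 2 ≤ k ≤ n − 1. If v_i is visible to v_j, then there exists t ∈ {1, …, k − 1} such that the chain vertex v_{i+t} is visible to both v_i and v_j. Equivalently (contrapositive), if no vertex of the chain ch(v_{i+1}, v_{j-1}) is visible to both v_i and v_j, then v_i is not visible to v_j. -/

import Mathlib

/-- A point in the Euclidean plane. -/
abbrev Plane := ℝ × ℝ

/-- A simple polygon with `n` vertices `v 0, …, v (n-1)` in counterclockwise order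
(indices mod `n`), given as a compact region `P` of the plane that is the closure of its
interior, whose frontier is the union of the closed edge segments `[v i, v (i+1)]`,
such that consecutive edges meet exactly in their common endpoint and non-consecutive
edges are disjoint; moreover no three distinct vertices are collinear. -/
structure SimplePolygon (n : ℕ) where
  three_le : 3 ≤ n
  v : ZMod n → Plane
  inj : Function.Injective v
  P : Set Plane
  compact : IsCompact P
  regular : P = closure (interior P)
  frontier_eq : frontier P = ⋃ i : ZMod n, segment ℝ (v i) (v (i + 1))
  edges_consecutive : ∀ i : ZMod n,
    segment ℝ (v i) (v (i + 1)) ∩ segment ℝ (v (i + 1)) (v (i + 1 + 1)) = {v (i + 1)}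
  edges_disjoint : ∀ i j : ZMod n, i ≠ j → j ≠ i + 1 → i ≠ j + 1 →
    Disjoint (segment ℝ (v i) (v (i + 1))) (segment ℝ (v j) (v (j + 1)))
  no_three_collinear : ∀ a b c : ZMod n, a ≠ b → a ≠ c → b ≠ c →
    ¬ Collinear ℝ ({v a, v b, v c} : Set Plane)

/-- `a` is visible to `b` in `P`: the closed segment `[a, b]` is contained in `P`. -/
def Visible (P : Set Plane) (a b : Plane) : Prop := segment ℝ a b ⊆ P

open Set Filter Topology

/-- Twice the signed area of the triangle `a b x`. -/
def cross (a b x : Plane) : ℝ := (b.1 - a.1) * (x.2 - a.2) - (b.2 - a.2) * (x.1 - a.1)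

/-- The linear functional `x ↦ det (u, x)`. -/
noncomputable def crossL (u : Plane) : Plane →L[ℝ] ℝ :=
  u.1 • ContinuousLinearMap.snd ℝ ℝ ℝ - u.2 • ContinuousLinearMap.fst ℝ ℝ ℝ

lemma crossL_apply (u x : Plane) : crossL u x = u.1 * x.2 - u.2 * x.1 := by
  simp [crossL]

/-- The open triangle `a b p`, described by positive barycentric coordinates. -/
def openTriangle (a b p : Plane) : Set Plane :=
  {x | ∃ α β γ : ℝ, 0 < α ∧ 0 < β ∧ 0 < γ ∧ α + β + γ = 1 ∧ x = α • a + β • b + γ • p}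

lemma cross_swap (a b x : Plane) : cross b a x = -cross a b x := by
  simp only [cross]; ring

lemma cross_combination (a b p : Plane) {α β γ : ℝ} (h : α + β + γ = 1) :
    cross a b (α • a + β • b + γ • p) = γ * cross a b p := by
  obtain rfl : α = 1 - β - γ := by linarith
  simp only [cross, Prod.fst_add, Prod.snd_add, Prod.smul_fst, Prod.smul_snd, smul_eq_mul]
  ring

lemma continuous_cross (a b : Plane) : Continuous (cross a b) := by
  unfold cross; fun_prop

lemma openTriangle_swap (a b p : Plane) : openTriangle b a p = openTriangle a b p := by
  ext x
  constructor <;> rintro ⟨α, β, γ, hα, hβ, hγ, h, rfl⟩ <;>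
    exact ⟨β, α, γ, hβ, hα, hγ, by linarith, by abel⟩

lemma convex_openTriangle (a b p : Plane) : Convex ℝ (openTriangle a b p) := by
  rintro _ ⟨α, β, γ, hα, hβ, hγ, h, rfl⟩ _ ⟨α', β', γ', hα', hβ', hγ', h', rfl⟩ s t hs ht hst
  have pos : ∀ {x y : ℝ}, 0 < x → 0 < y → 0 < s * x + t * y := by
    intro x y hx hy
    rcases hs.eq_or_lt with rfl | hs
    · have : t = 1 := by linarith
      simpa [this] using hy
    · have := mul_pos hs hx
      have := mul_nonneg ht hy.le
      linarith
  refine ⟨s * α + t * α', s * β + t * β', s * γ + t * γ', pos hα hα', pos hβ hβ', pos hγ hγ',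
    ?_, by module⟩
  linear_combination s * h + t * h' + hst

lemma cross_pos_of_mem_openTriangle {a b p x : Plane} (hp : 0 < cross a b p)
    (hx : x ∈ openTriangle a b p) : 0 < cross a b x := by
  obtain ⟨α, β, γ, hα, hβ, hγ, h, rfl⟩ := hx
  rw [cross_combination a b p h]
  positivity

lemma eq_combination {a b p : Plane} (hp : cross a b p ≠ 0) (x : Plane) :
    x = (cross b p x / cross a b p) • a + (cross p a x / cross a b p) • b
      + (cross a b x / cross a b p) • p := by
  ext
  · simp only [Prod.fst_add, Prod.smul_fst, smul_eq_mul]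
    field_simp
    simp only [cross]; ring
  · simp only [Prod.snd_add, Prod.smul_snd, smul_eq_mul]
    field_simp
    simp only [cross]; ring

lemma combination_sum {a b p : Plane} (hp : cross a b p ≠ 0) (x : Plane) :
    cross b p x / cross a b p + cross p a x / cross a b p + cross a b x / cross a b p = 1 := by
  field_simp
  simp only [cross]; ring

lemma isOpen_openTriangle_of_pos {a b p : Plane} (hp : 0 < cross a b p) :
    IsOpen (openTriangle a b p) := by
  have : openTriangle a b p = {x | 0 < cross b p x} ∩ {x | 0 < cross p a x} ∩
      {x | 0 < cross a b x} := by
    ext x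
    constructor
    · rintro ⟨α, β, γ, hα, hβ, hγ, h, rfl⟩
      have h1 : cross b p (α • a + β • b + γ • p) = α * cross a b p := by
        obtain rfl : β = 1 - α - γ := by linarith
        simp only [cross, Prod.fst_add, Prod.snd_add, Prod.smul_fst, Prod.smul_snd, smul_eq_mul]
        ring
      have h2 : cross p a (α • a + β • b + γ • p) = β * cross a b p := by
        obtain rfl : α = 1 - β - γ := by linarith
        simp only [cross, Prod.fst_add, Prod.snd_add, Prod.smul_fst, Prod.smul_snd, smul_eq_mul]
        ring
      simp only [mem_inter_iff, mem_ofPred_eq, h1, h2, cross_combination a b p h]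
      exact ⟨⟨by positivity, by positivity⟩, by positivity⟩
    · rintro ⟨⟨h1, h2⟩, h3⟩
      exact ⟨_, _, _, div_pos h1 hp, div_pos h2 hp, div_pos h3 hp, combination_sum hp.ne' x,
        eq_combination hp.ne' x⟩
  rw [this]
  exact (((isOpen_lt continuous_const (continuous_cross b p)).inter
    (isOpen_lt continuous_const (continuous_cross p a))).inter
    (isOpen_lt continuous_const (continuous_cross a b)))

lemma isOpen_openTriangle {a b p : Plane} (hp : cross a b p ≠ 0) :
    IsOpen (openTriangle a b p) := by
  rcases hp.lt_or_gt with h | h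
  · rw [← openTriangle_swap]
    exact isOpen_openTriangle_of_pos (by rw [cross_swap]; linarith)
  · exact isOpen_openTriangle_of_pos h

lemma mem_closure_openTriangle (a b p : Plane) {α β γ : ℝ} (hα : 0 ≤ α) (hβ : 0 ≤ β)
    (hγ : 0 ≤ γ) (h : α + β + γ = 1) :
    α • a + β • b + γ • p ∈ closure (openTriangle a b p) := by
  have hsub : openSegment ℝ (α • a + β • b + γ • p)
      ((1 / 3 : ℝ) • a + (1 / 3 : ℝ) • b + (1 / 3 : ℝ) • p) ⊆ openTriangle a b p := by
    rintro _ ⟨s, t, hs, ht, hst, rfl⟩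
    refine ⟨s * α + t * (1 / 3), s * β + t * (1 / 3), s * γ + t * (1 / 3), by positivity,
      by positivity, by positivity, ?_, by module⟩
    linear_combination s * h + hst
  exact closure_mono hsub (segment_subset_closure_openSegment (left_mem_segment ℝ _ _))

lemma openTriangle_subset_openTriangle (a b p : Plane) {α β γ : ℝ} (hα : 0 ≤ α) (hβ : 0 ≤ β)
    (hγ : 0 < γ) (h : α + β + γ = 1) :
    openTriangle a b (α • a + β • b + γ • p) ⊆ openTriangle a b p := by
  rintro _ ⟨α', β', γ', hα', hβ', hγ', h', rfl⟩
  refine ⟨α' + γ' * α, β' + γ' * β, γ' * γ, by positivity, by positivity, by positivity, ?_,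
    by module⟩
  linear_combination h' + γ' * h

lemma exists_of_mem_convexHull_triple {a b p x : Plane} (hx : x ∈ convexHull ℝ {a, b, p}) :
    ∃ α β γ : ℝ, 0 ≤ α ∧ 0 ≤ β ∧ 0 ≤ γ ∧ α + β + γ = 1 ∧ x = α • a + β • b + γ • p := by
  rw [convexHull_insert (by simp), convexHull_pair, mem_convexJoin] at hx
  obtain ⟨y, hy, z, ⟨s, t, hs, ht, hst, rfl⟩, s', t', hs', ht', hst', rfl⟩ := hx
  obtain rfl : y = a := hy
  refine ⟨s', t' * s, t' * t, hs', by positivity, by positivity, ?_, by module⟩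
  linear_combination hst' + t' * hst

/-- If a line separates `S` weakly from `a, b` and strictly from `p`, then all open triangles
`a b p'` with `p'` close to `p` avoid `S`. -/
lemma eventually_disjoint_openTriangle {a b p : Plane} {S : Set Plane} (f : Plane →L[ℝ] ℝ)
    {c : ℝ} (ha : f a ≤ c) (hb : f b ≤ c) (hp : f p < c) (hS : ∀ x ∈ S, c ≤ f x) :
    ∀ᶠ p' in 𝓝 p, Disjoint S (openTriangle a b p') := by
  filter_upwards [f.continuous.continuousAt.eventually_lt_const hp] with p' hp'
  rw [Set.disjoint_left]
  rintro _ hx ⟨α, β, γ, hα, hβ, hγ, h, rfl⟩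
  have := hS _ hx
  simp only [map_add, map_smul, smul_eq_mul] at this
  have h1 := mul_le_mul_of_nonneg_left ha hα.le
  have h2 := mul_le_mul_of_nonneg_left hb hβ.le
  have h3 := mul_lt_mul_of_pos_left hp' hγ
  have h4 : α * c + β * c + γ * c = c := by linear_combination c * h
  linarith

lemma eventually_disjoint_openTriangle_of_disjoint {a b p : Plane} {S : Set Plane}
    (hS : IsCompact S) (hS' : Convex ℝ S) (h : Disjoint S (convexHull ℝ {a, b, p})) :
    ∀ᶠ p' in 𝓝 p, Disjoint S (openTriangle a b p') := by
  obtain ⟨f, u, w, h1, huw, h2⟩ := geometric_hahn_banach_compact_closed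
    (convex_convexHull ℝ {a, b, p}) ((Set.toFinite {a, b, p}).isCompact_convexHull ℝ) hS' hS.isClosed
    h.symm
  have hm : ∀ x ∈ ({a, b, p} : Set Plane), f x < u := fun x hx => h1 x (subset_convexHull ℝ _ hx)
  exact eventually_disjoint_openTriangle f (c := u) (hm a (by simp)).le (hm b (by simp)).le
    (hm p (by simp)) fun x hx => (huw.trans (h2 x hx)).le

lemma isCompact_segment (a b : Plane) : IsCompact (segment ℝ a b) := by
  rw [← convexHull_pair (𝕜 := ℝ)]
  exact ((Set.toFinite {a, b}).isCompact_convexHull ℝ)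

lemma collinear_of_cross_eq_zero {a b x : Plane} (hab : a ≠ b) (h : cross a b x = 0) :
    Collinear ℝ ({a, b, x} : Set Plane) := by
  rw [collinear_iff_of_mem (p₀ := a) (by simp)]
  have hpos : (b.1 - a.1) ^ 2 + (b.2 - a.2) ^ 2 ≠ 0 := by
    intro h0
    apply hab
    have h1 : b.1 - a.1 = 0 := by nlinarith [sq_nonneg (b.1 - a.1), sq_nonneg (b.2 - a.2)]
    have h2 : b.2 - a.2 = 0 := by nlinarith [sq_nonneg (b.1 - a.1), sq_nonneg (b.2 - a.2)]
    ext <;> linarith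
  refine ⟨b - a, ?_⟩
  simp only [mem_insert_iff, mem_singleton_iff, forall_eq_or_imp, forall_eq]
  refine ⟨⟨0, by simp⟩, ⟨1, by simp⟩,
    ((x.1 - a.1) * (b.1 - a.1) + (x.2 - a.2) * (b.2 - a.2)) /
      ((b.1 - a.1) ^ 2 + (b.2 - a.2) ^ 2), ?_⟩
  simp only [cross] at h
  ext
  · simp only [vadd_eq_add, Prod.fst_add, Prod.smul_fst, Prod.fst_sub, smul_eq_mul]
    field_simp
    linear_combination (-(b.2 - a.2)) * h
  · simp only [vadd_eq_add, Prod.snd_add, Prod.smul_snd, Prod.snd_sub, smul_eq_mul]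
    field_simp
    linear_combination (b.1 - a.1) * h

/-- A preconnected set avoiding the frontier of `P` that meets the interior of `P` lies in it. -/
lemma IsPreconnected.subset_interior_of_disjoint_frontier {S P : Set Plane}
    (hP : IsClosed P) (hS : IsPreconnected S) (hd : Disjoint S (frontier P))
    (hne : (S ∩ interior P).Nonempty) : S ⊆ interior P := by
  refine hS.subset_left_of_subset_union isOpen_interior hP.isOpen_compl
    (Set.disjoint_left.2 fun x hx hx' => hx' (interior_subset hx)) (fun x hx => ?_) hne
  by_contra hcon
  rw [mem_union, not_or, mem_compl_iff, not_not] at hcon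
  exact Set.disjoint_left.1 hd hx (hP.frontier_eq ▸ ⟨hcon.2, hcon.1⟩)

/-- Supporting line of a nondegenerate open triangle separating it from a disjoint segment. -/
lemma exists_separating_functional {a b p c d : Plane} (hp : cross a b p ≠ 0)
    (hd : Disjoint (segment ℝ c d) (openTriangle a b p)) :
    ∃ (f : Plane →L[ℝ] ℝ) (u : ℝ), f a ≤ u ∧ f b ≤ u ∧ f p ≤ u ∧ u ≤ f c ∧ u ≤ f d ∧
      f a + f b + f p < 3 * u := by
  obtain ⟨f, u, h1, h2⟩ := geometric_hahn_banach_open (convex_openTriangle a b p)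
    (isOpen_openTriangle hp) (convex_segment c d) hd.symm
  have hcl : ∀ x ∈ closure (openTriangle a b p), f x ≤ u := fun x hx =>
    closure_minimal (fun y hy => (h1 y hy).le) (isClosed_le f.continuous continuous_const) hx
  refine ⟨f, u, hcl _ ?_, hcl _ ?_, hcl _ ?_, h2 _ (left_mem_segment ℝ c d),
    h2 _ (right_mem_segment ℝ c d), ?_⟩
  · simpa using mem_closure_openTriangle a b p zero_le_one le_rfl le_rfl (by norm_num)
  · simpa using mem_closure_openTriangle a b p le_rfl zero_le_one le_rfl (by norm_num)
  · simpa using mem_closure_openTriangle a b p le_rfl le_rfl zero_le_one (by norm_num)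
  · have := h1 ((1 / 3 : ℝ) • a + (1 / 3 : ℝ) • b + (1 / 3 : ℝ) • p)
      ⟨1 / 3, 1 / 3, 1 / 3, by norm_num, by norm_num, by norm_num, by norm_num, rfl⟩
    simp only [map_add, map_smul, smul_eq_mul] at this
    linarith

lemma le_on_segment {c d : Plane} (f : Plane →L[ℝ] ℝ) {u : ℝ} (hc : u ≤ f c) (hd : u ≤ f d) :
    ∀ x ∈ segment ℝ c d, u ≤ f x := by
  rintro _ ⟨s, t, hs, ht, hst, rfl⟩
  simp only [map_add, map_smul, smul_eq_mul]
  have h1 := mul_le_mul_of_nonneg_left hc hs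
  have h2 := mul_le_mul_of_nonneg_left hd ht
  have : s * u + t * u = u := by linear_combination u * hst
  linarith

/-- An open triangle whose apex slides along an edge keeps avoiding this edge. -/
lemma disjoint_openTriangle_slide {a b p c d : Plane} (hp : cross a b p ≠ 0)
    (hd : Disjoint (segment ℝ c d) (openTriangle a b p)) (hpo : p ∈ openSegment ℝ c d) (r : ℝ) :
    Disjoint (segment ℝ c d) (openTriangle a b (p + r • (d - c))) := by
  obtain ⟨f, u, ha, hb, hp', hc, hd', hlt⟩ := exists_separating_functional hp hd
  obtain ⟨s, t, hs, ht, hst, hsum⟩ := hpo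
  have hfp : f p = s * f c + t * f d := by
    rw [← hsum]; simp
  have hs' : s = 1 - t := by linarith
  have hc' : f c = u := by
    by_contra hne
    have := mul_pos hs (sub_pos.2 (lt_of_le_of_ne hc (Ne.symm hne)))
    have := mul_nonneg ht.le (sub_nonneg.2 hd')
    subst hs'
    nlinarith
  have hd'' : f d = u := by
    by_contra hne
    have := mul_pos ht (sub_pos.2 (lt_of_le_of_ne hd' (Ne.symm hne)))
    have := mul_nonneg hs.le (sub_nonneg.2 hc)
    subst hs'
    nlinarith
  have hfpu : f p = u := by rw [hfp, hc', hd'']; linear_combination u * hst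
  rw [Set.disjoint_left]
  rintro x hx ⟨α, β, γ, hα, hβ, hγ, h, rfl⟩
  have hux := le_on_segment f hc hd' _ hx
  simp only [map_add, map_smul, smul_eq_mul, map_sub, hc', hd'', hfpu] at hux
  have h1 := mul_nonneg hα.le (sub_nonneg.2 ha)
  have h2 := mul_nonneg hβ.le (sub_nonneg.2 hb)
  have h4 : α * u + β * u + γ * u = u := by linear_combination u * h
  have h5 : α * (u - f a) = 0 := by linarith
  have h6 : β * (u - f b) = 0 := by linarith
  have h7 := (mul_eq_zero.1 h5).resolve_left hα.ne'
  have h8 := (mul_eq_zero.1 h6).resolve_left hβ.ne'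
  linarith

/-- A segment touching the side `a p` of an open triangle that it avoids, without containing the
ends of this side, lies along this side. -/
lemma left_mem_openSegment_of_touch {a b p c d x : Plane} (hp : cross a b p ≠ 0)
    (hd : Disjoint (segment ℝ c d) (openTriangle a b p)) (hx : x ∈ openSegment ℝ c d)
    (hx' : x ∈ openSegment ℝ a p) (ha : a ∉ segment ℝ c d) (hpn : p ∉ segment ℝ c d) :
    c ∈ openSegment ℝ a p := by
  obtain ⟨f, u, fa, fb, fp, fc, fd, hlt⟩ := exists_separating_functional hp hd
  obtain ⟨s, t, hs, ht, hst, hsum⟩ := hx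
  obtain ⟨s', t', hs', ht', hst', hsum'⟩ := hx'
  have e1 : f x = s * f c + t * f d := by rw [← hsum]; simp
  have e2 : f x = s' * f a + t' * f p := by rw [← hsum']; simp
  have g1 := mul_nonneg hs.le (sub_nonneg.2 fc)
  have g2 := mul_nonneg ht.le (sub_nonneg.2 fd)
  have g3 := mul_nonneg hs'.le (sub_nonneg.2 fa)
  have g4 := mul_nonneg ht'.le (sub_nonneg.2 fp)
  have i1 : s * u + t * u = u := by linear_combination u * hst
  have i2 : s' * u + t' * u = u := by linear_combination u * hst'
  have z1 : f c - u = 0 :=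
    (mul_eq_zero.1 (show s * (f c - u) = 0 by linarith)).resolve_left hs.ne'
  have z2 : f d - u = 0 :=
    (mul_eq_zero.1 (show t * (f d - u) = 0 by linarith)).resolve_left ht.ne'
  have z3 : u - f a = 0 :=
    (mul_eq_zero.1 (show s' * (u - f a) = 0 by linarith)).resolve_left hs'.ne'
  have z4 : u - f p = 0 :=
    (mul_eq_zero.1 (show t' * (u - f p) = 0 by linarith)).resolve_left ht'.ne'
  have key : ∀ y, f y = u → ∃ r : ℝ, y = a + r • (p - a) := by
    intro y hy
    have h1 := eq_combination hp y
    have h2 := combination_sum hp y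
    set α := cross b p y / cross a b p
    set β := cross p a y / cross a b p
    set γ := cross a b y / cross a b p
    have h3 : f y = α * f a + β * f b + γ * f p := by
      conv_lhs => rw [h1]
      simp
    have h4 : β * (f b - u) = 0 := by
      linear_combination hy - h3 + α * z3 + γ * z4 - u * h2
    have h5 : β = 0 := (mul_eq_zero.1 h4).resolve_right (by linarith)
    refine ⟨γ, ?_⟩
    have h6 : α = 1 - γ := by linarith
    rw [h5, h6] at h1
    rw [h1]; module
  obtain ⟨r, rfl⟩ := key c (by linarith)
  obtain ⟨r', rfl⟩ := key d (by linarith)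
  have hpa : p - a ≠ 0 := by
    intro h0
    rw [sub_eq_zero] at h0
    apply hp
    simp only [h0, cross]; ring
  have hr : s * r + t * r' = t' := by
    have : (s * r + t * r' - t') • (p - a) = 0 := by
      have h1 : s • (a + r • (p - a)) + t • (a + r' • (p - a)) = s' • a + t' • p := by
        rw [hsum, hsum']
      have h2 : s = 1 - t := by linarith
      have h3 : s' = 1 - t' := by linarith
      subst h2 h3
      rw [← sub_eq_zero] at h1
      rw [← h1]; module
    have := (smul_eq_zero.1 this).resolve_right hpa
    linarith
  have r0 : 0 < r := by
    by_contra! hcon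
    have hr' : 0 < r' := by
      by_contra! hcon'
      nlinarith
    apply ha
    refine ⟨r' / (r' - r), -r / (r' - r), div_nonneg hr'.le (by linarith),
      div_nonneg (by linarith) (by linarith), ?_, ?_⟩
    · have : r' - r ≠ 0 := by linarith
      field_simp; ring
    · have : r' - r ≠ 0 := by linarith
      have h1 : r' / (r' - r) = 1 - (-r / (r' - r)) := by field_simp; ring
      have h2 : (1 - (-r / (r' - r))) * r + (-r / (r' - r)) * r' = 0 := by field_simp; ring
      rw [h1]
      linear_combination (norm := module) h2 • (p - a)
  have r1 : r < 1 := by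
    by_contra! hcon
    have hr' : r' < 1 := by
      by_contra! hcon'
      nlinarith
    apply hpn
    refine ⟨(1 - r') / (r - r'), (r - 1) / (r - r'), div_nonneg (by linarith) (by linarith),
      div_nonneg (by linarith) (by linarith), ?_, ?_⟩
    · have : r - r' ≠ 0 := by linarith
      field_simp; ring
    · have : r - r' ≠ 0 := by linarith
      have h1 : (1 - r') / (r - r') = 1 - ((r - 1) / (r - r')) := by field_simp; ring
      have h2 : (1 - ((r - 1) / (r - r'))) * r + ((r - 1) / (r - r')) * r' = 1 := by
        field_simp; ring
      rw [h1]
      linear_combination (norm := module) h2 • (p - a)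
  exact ⟨1 - r, r, by linarith, r0, by ring, by module⟩

/-- Local stability at a segment issuing from the base vertex `a`. -/
lemma eventually_disjoint_openTriangle_of_base {a b g p : Plane} (hp : cross a b p ≠ 0)
    (hg : cross a b g ≠ 0) (hd : Disjoint (segment ℝ a g) (openTriangle a b p))
    (hpg : p ∉ segment ℝ a g) (hgp : g ∉ segment ℝ a p) :
    ∀ᶠ p' in 𝓝 p, Disjoint (segment ℝ a g) (openTriangle a b p') := by
  have h1 := eq_combination hp g
  have h2 := combination_sum hp g
  have hy' : cross p a g / cross a b p = cross a g p / cross a b p := by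
    congr 1; simp only [cross]; ring
  rw [hy'] at h1 h2
  set x := cross b p g / cross a b p
  set y := cross a g p / cross a b p with hy
  set z := cross a b g / cross a b p with hz
  have hz0 : z ≠ 0 := div_ne_zero hg hp
  have hx : x = 1 - y - z := by linarith
  rw [hx] at h1
  have hsep : ∀ f : Plane →L[ℝ] ℝ, f b ≤ f a → f p < f a → f a ≤ f g →
      ∀ᶠ p' in 𝓝 p, Disjoint (segment ℝ a g) (openTriangle a b p') := fun f hb hp' hg' =>
    eventually_disjoint_openTriangle f le_rfl hb hp' (le_on_segment f le_rfl hg')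
  rcases hz0.lt_or_gt with hz1 | hz1
  · have e : ∀ w : Plane, (-(1 / cross a b p) • crossL (b - a)) w
        = (-(1 / cross a b p) • crossL (b - a)) a - cross a b w / cross a b p := by
      intro w
      simp only [smul_apply, crossL_apply, smul_eq_mul, Prod.fst_sub,
        Prod.snd_sub]
      field_simp
      simp only [cross]; ring
    refine hsep (-(1 / cross a b p) • crossL (b - a)) ?_ ?_ ?_
    · rw [e b]; simp [cross, mul_comm]
    · rw [e p, div_self hp]; linarith
    · rw [e g]; linarith
  · rcases lt_trichotomy y 0 with hy0 | hy0 | hy0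
    · have e : ∀ w : Plane, ((1 / cross a b p) • crossL (g - a)) w
          = ((1 / cross a b p) • crossL (g - a)) a + cross a g w / cross a b p := by
        intro w
        simp only [smul_apply, crossL_apply, smul_eq_mul, Prod.fst_sub,
          Prod.snd_sub]
        field_simp
        simp only [cross]; ring
      refine hsep ((1 / cross a b p) • crossL (g - a)) ?_ ?_ ?_
      · rw [e b]
        have : cross a g b / cross a b p = -z := by
          rw [hz, ← neg_div]; congr 1; simp only [cross]; ring
        linarith
      · rw [e p]; linarith
      · rw [e g]; simp [cross, mul_comm]
    · exfalso
      rcases le_total z 1 with h | h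
      · apply hgp
        refine ⟨1 - z, z, by linarith, hz1.le, by ring, ?_⟩
        conv_rhs => rw [h1, hy0]
        module
      · apply hpg
        refine ⟨1 - 1 / z, 1 / z, ?_, by positivity, by ring, ?_⟩
        · rw [sub_nonneg, div_le_one hz1]; exact h
        · conv_lhs => rw [h1, hy0]
          have : (1 / z) * z = 1 := by field_simp
          linear_combination (norm := module) this • (p - a)
    · exfalso
      have hs : 0 < 2 + y + z := by linarith
      refine @Set.disjoint_left _ _ _ |>.1 hd
        (show (1 - 1 / (2 + y + z)) • a + (1 / (2 + y + z)) • g ∈ segment ℝ a g from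
        ⟨_, _, ?_, by positivity, by ring, rfl⟩)
        ⟨2 / (2 + y + z), y / (2 + y + z), z / (2 + y + z), by positivity, by positivity,
          by positivity, by field_simp, ?_⟩
      · rw [sub_nonneg, div_le_one hs]; linarith
      · conv_lhs => rw [h1]
        have e1 : 2 / (2 + y + z) = 1 - 1 / (2 + y + z) + 1 / (2 + y + z) * (1 - y - z) := by
          field_simp; ring
        have e2 : y / (2 + y + z) = 1 / (2 + y + z) * y := by ring
        have e3 : z / (2 + y + z) = 1 / (2 + y + z) * z := by ring
        rw [e1, e2, e3]
        module

/-- Thin triangles over `a b` avoid a segment issuing from `a`. -/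
lemma eventually_disjoint_thin_openTriangle {a b g q : Plane} (hg : cross a b g ≠ 0)
    (hq : q ∈ openSegment ℝ a b) :
    ∀ᶠ p' in 𝓝 q, Disjoint (segment ℝ a g) (openTriangle a b p') := by
  have e : ∀ w : Plane, ((cross a b g) • crossL (g - a)) w
      = ((cross a b g) • crossL (g - a)) a + cross a b g * cross a g w := by
    intro w
    simp only [smul_apply, crossL_apply, smul_eq_mul, Prod.fst_sub,
      Prod.snd_sub]
    simp only [cross]; ring
  set f := (cross a b g) • crossL (g - a)
  have hb : f b < f a := by
    have : cross a g b = -cross a b g := by simp only [cross]; ring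
    rw [e b, this]
    nlinarith [mul_self_pos.2 hg]
  have hfg : f a ≤ f g := by rw [e g]; simp [cross, mul_comm]
  obtain ⟨s, t, hs, ht, hst, rfl⟩ := hq
  refine eventually_disjoint_openTriangle f le_rfl hb.le ?_ (le_on_segment f le_rfl hfg)
  simp only [map_add, map_smul, smul_eq_mul]
  have : s * f a + t * f a = f a := by linear_combination f a * hst
  have := mul_lt_mul_of_pos_left hb ht
  linarith

lemma half_smul_add_half_smul_mem_openSegment (a b : Plane) :
    (1 / 2 : ℝ) • a + (1 / 2 : ℝ) • b ∈ openSegment ℝ a b :=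
  ⟨1 / 2, 1 / 2, by norm_num, by norm_num, by norm_num, rfl⟩

namespace SimplePolygon

/-- The edge from the vertex `m` to the next one. -/
def edge {n : ℕ} (SP : SimplePolygon n) (m : ZMod n) : Set Plane :=
  segment ℝ (SP.v m) (SP.v (m + 1))

lemma ne_add_one {n : ℕ} (SP : SimplePolygon n) (m : ZMod n) : m ≠ m + 1 := by
  have : Fact (1 < n) := ⟨by have := SP.three_le; omega⟩
  simp

lemma isClosed {n : ℕ} (SP : SimplePolygon n) : IsClosed SP.P := SP.compact.isClosed

lemma eq_or_eq_of_mem_segment {n : ℕ} (SP : SimplePolygon n) {m l r : ZMod n} (hlr : l ≠ r)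
    (h : SP.v m ∈ segment ℝ (SP.v l) (SP.v r)) : m = l ∨ m = r := by
  by_contra! hcon
  exact SP.no_three_collinear l m r hcon.1.symm hlr hcon.2 (mem_segment_iff_wbtw.1 h).collinear

lemma cross_ne_zero {n : ℕ} (SP : SimplePolygon n) {l m r : ZMod n} (hlm : l ≠ m) (hlr : l ≠ r)
    (hmr : m ≠ r) : cross (SP.v l) (SP.v m) (SP.v r) ≠ 0 := fun h =>
  SP.no_three_collinear l m r hlm hlr hmr
    (collinear_of_cross_eq_zero (fun h' => hlm (SP.inj h')) h)

lemma edge_subset_frontier {n : ℕ} (SP : SimplePolygon n) (m : ZMod n) :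
    SP.edge m ⊆ frontier SP.P := by
  rw [SP.frontier_eq]
  exact subset_iUnion (fun i : ZMod n => segment ℝ (SP.v i) (SP.v (i + 1))) m

lemma exists_mem_edge {n : ℕ} (SP : SimplePolygon n) {x : Plane} (hx : x ∈ frontier SP.P) :
    ∃ m, x ∈ SP.edge m := by
  rw [SP.frontier_eq] at hx
  exact mem_iUnion.1 hx

lemma disjoint_edge_of_subset_interior {n : ℕ} (SP : SimplePolygon n) (m : ZMod n) {S : Set Plane}
    (hS : S ⊆ interior SP.P) : Disjoint (SP.edge m) S :=
  Set.disjoint_left.2 fun _ hx hx' => (SP.edge_subset_frontier m hx).2 (hS hx')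

/-- Two distinct edges meet only in vertices. -/
lemma exists_vertex_of_mem_edges {n : ℕ} (SP : SimplePolygon n) {l m : ZMod n} (hlm : l ≠ m)
    {x : Plane} (hl : x ∈ SP.edge l) (hm : x ∈ SP.edge m) : ∃ r, x = SP.v r := by
  by_cases h1 : m = l + 1
  · subst h1
    have : x ∈ ({SP.v (l + 1)} : Set Plane) := SP.edges_consecutive l ▸ ⟨hl, hm⟩
    exact ⟨_, this⟩
  · by_cases h2 : l = m + 1
    · subst h2
      have : x ∈ ({SP.v (m + 1)} : Set Plane) := SP.edges_consecutive m ▸ ⟨hm, hl⟩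
      exact ⟨_, this⟩
    · exact absurd hm (Set.disjoint_left.1 (SP.edges_disjoint l m hlm h1 h2) hl)

lemma mem_openSegment_of_mem_edge {n : ℕ} (SP : SimplePolygon n) {m : ZMod n} {x : Plane}
    (hx : x ∈ SP.edge m) (hv : ∀ r, x ≠ SP.v r) :
    x ∈ openSegment ℝ (SP.v m) (SP.v (m + 1)) :=
  mem_openSegment_of_ne_left_right (hv _).symm (hv _).symm hx

/-- No edge meets the open segment from `v i` to `v j`, unless this segment is an edge. -/
def IsFree {n : ℕ} (SP : SimplePolygon n) (i j : ZMod n) : Prop :=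
  ∀ m, Disjoint (SP.edge m) (openSegment ℝ (SP.v i) (SP.v j)) ∨
    SP.edge m ⊆ segment ℝ (SP.v i) (SP.v j)

lemma IsFree.symm {n : ℕ} {SP : SimplePolygon n} {i j : ZMod n} (h : SP.IsFree i j) :
    SP.IsFree j i := fun m => by
  rw [openSegment_symm, segment_symm]
  exact h m

/-- An edge through `v i` disjoint from the open segment from `v i` to `v j` leads from `v i` to
a third vertex. -/
lemma exists_edge_eq_segment {n : ℕ} (SP : SimplePolygon n) {i j m : ZMod n} (hij : i ≠ j)
    (hd : Disjoint (SP.edge m) (openSegment ℝ (SP.v i) (SP.v j))) (hi : SP.v i ∈ SP.edge m) :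
    ∃ r, r ≠ i ∧ r ≠ j ∧ SP.edge m = segment ℝ (SP.v i) (SP.v r) := by
  have key : ∀ r, r ≠ i → SP.edge m = segment ℝ (SP.v i) (SP.v r) →
      ∃ r, r ≠ i ∧ r ≠ j ∧ SP.edge m = segment ℝ (SP.v i) (SP.v r) := by
    intro r hri hr
    refine ⟨r, hri, ?_, hr⟩
    rintro rfl
    exact Set.disjoint_left.1 hd
      (hr ▸ openSegment_subset_segment ℝ _ _
        (half_smul_add_half_smul_mem_openSegment (SP.v i) (SP.v r)))
      (half_smul_add_half_smul_mem_openSegment _ _)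
  rcases SP.eq_or_eq_of_mem_segment (SP.ne_add_one m) hi with rfl | rfl
  · exact key _ (SP.ne_add_one i).symm rfl
  · exact key _ (SP.ne_add_one m) (segment_symm ℝ _ _)

lemma eventually_disjoint_of_base_mem {n : ℕ} (SP : SimplePolygon n) {i j m : ZMod n}
    (hij : i ≠ j) {p : Plane} (hp : cross (SP.v i) (SP.v j) p ≠ 0)
    (hT : openTriangle (SP.v i) (SP.v j) p ⊆ interior SP.P)
    (hvert : ∀ r, SP.v r ∈ convexHull ℝ {SP.v i, SP.v j, p} → r = i ∨ r = j)
    (hd : Disjoint (SP.edge m) (openSegment ℝ (SP.v i) (SP.v j)))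
    (hpm : p ∉ SP.edge m) (hi : SP.v i ∈ SP.edge m) :
    ∀ᶠ p' in 𝓝 p, Disjoint (SP.edge m) (openTriangle (SP.v i) (SP.v j) p') := by
  obtain ⟨r, hri, hrj, hr⟩ := SP.exists_edge_eq_segment hij hd hi
  rw [hr] at hpm ⊢
  refine eventually_disjoint_openTriangle_of_base hp (SP.cross_ne_zero hij hri.symm hrj.symm)
    (hr ▸ SP.disjoint_edge_of_subset_interior m hT) hpm fun hmem => ?_
  have : SP.v r ∈ convexHull ℝ {SP.v i, SP.v j, p} := by
    refine segment_subset_convexHull ?_ ?_ hmem <;> simp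
  rcases hvert r this with h | h
  · exact hri h
  · exact hrj h

lemma eventually_disjoint_edge {n : ℕ} (SP : SimplePolygon n) {i j : ZMod n} (hij : i ≠ j)
    (hfree : SP.IsFree i j) {p : Plane} (hp : 0 < cross (SP.v i) (SP.v j) p)
    (hT : openTriangle (SP.v i) (SP.v j) p ⊆ interior SP.P)
    (hvert : ∀ r, SP.v r ∈ convexHull ℝ {SP.v i, SP.v j, p} → r = i ∨ r = j)
    (m : ZMod n) (hpm : p ∉ SP.edge m) :
    ∀ᶠ p' in 𝓝 p, Disjoint (SP.edge m) (openTriangle (SP.v i) (SP.v j) p') := by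
  rcases hfree m with hd | hsub
  swap
  · filter_upwards [(continuous_cross _ _).continuousAt.eventually_const_lt hp] with p' hp'
    rw [Set.disjoint_left]
    intro x hx hx'
    obtain ⟨s, t, hs, ht, hst, rfl⟩ := hsub hx
    have h1 := cross_pos_of_mem_openTriangle hp' hx'
    have h2 := cross_combination (SP.v i) (SP.v j) p (α := s) (β := t) (γ := 0) (by linarith)
    rw [zero_smul, add_zero, zero_mul] at h2
    linarith
  by_cases hi : SP.v i ∈ SP.edge m
  · exact SP.eventually_disjoint_of_base_mem hij hp.ne' hT hvert hd hpm hi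
  by_cases hj : SP.v j ∈ SP.edge m
  · have hswap := SP.eventually_disjoint_of_base_mem hij.symm (p := p) (m := m)
      (by rw [cross_swap]; exact neg_ne_zero.2 hp.ne') (by rwa [openTriangle_swap])
      (fun r hr => (hvert r (by rwa [Set.insert_comm] at hr)).symm) (by rwa [openSegment_symm])
      hpm hj
    simpa only [openTriangle_swap] using hswap
  refine eventually_disjoint_openTriangle_of_disjoint (isCompact_segment _ _)
    (convex_segment _ _) (Set.disjoint_left.2 fun x hx hx' => ?_)
  have hdT := SP.disjoint_edge_of_subset_interior m hT
  have hxv : ∀ r, x ≠ SP.v r := by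
    rintro r rfl
    rcases hvert r hx' with rfl | rfl
    · exact hi hx
    · exact hj hx
  have hxo := SP.mem_openSegment_of_mem_edge hx hxv
  obtain ⟨α, β, γ, hα, hβ, hγ, h, rfl⟩ := exists_of_mem_convexHull_triple hx'
  have hside : ∀ k l : ZMod n, k ≠ l → cross (SP.v k) (SP.v l) p ≠ 0 →
      openTriangle (SP.v k) (SP.v l) p ⊆ interior SP.P →
      SP.v k ∉ SP.edge m →
      (∀ r, SP.v r ∈ segment ℝ (SP.v k) p → r = k ∨ r = l) →
      α • SP.v i + β • SP.v j + γ • p ∉ openSegment ℝ (SP.v k) p := by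
    intro k l hkl hc hT' hk hv hmem
    have hmo := left_mem_openSegment_of_touch hc (SP.disjoint_edge_of_subset_interior m hT')
      hxo hmem hk hpm
    rcases hv m (openSegment_subset_segment ℝ _ _ hmo) with rfl | rfl
    · exact hk (left_mem_segment ℝ _ _)
    · obtain ⟨s, t, hs, ht, hst, he⟩ := hmo
      have h2 := cross_combination (SP.v k) (SP.v m) p (α := s) (β := 0) (γ := t) (by linarith)
      rw [zero_smul, add_zero, he] at h2
      have h3 : cross (SP.v k) (SP.v m) (SP.v m) = 0 := by simp only [cross]; ring
      rw [h3] at h2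
      exact (mul_ne_zero ht.ne' hc) h2.symm
  have hvi : ∀ r, SP.v r ∈ segment ℝ (SP.v i) p → r = i ∨ r = j := fun r hr =>
    hvert r (segment_subset_convexHull (by simp) (by simp) hr)
  have hvj : ∀ r, SP.v r ∈ segment ℝ (SP.v j) p → r = j ∨ r = i := fun r hr =>
    (hvert r (segment_subset_convexHull (by simp) (by simp) hr)).symm
  rcases hγ.eq_or_lt with rfl | hγ
  · have hseg : α • SP.v i + β • SP.v j + (0 : ℝ) • p ∈ segment ℝ (SP.v i) (SP.v j) :=
      ⟨α, β, hα, hβ, by linarith, by simp⟩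
    exact Set.disjoint_left.1 hd hx
      (mem_openSegment_of_ne_left_right (hxv i).symm (hxv j).symm hseg)
  rcases hα.eq_or_lt with rfl | hα <;> rcases hβ.eq_or_lt with rfl | hβ
  · apply hpm
    have : γ = 1 := by linarith
    simpa [this] using hx
  · exact hside j i hij.symm (by rw [cross_swap]; exact neg_ne_zero.2 hp.ne')
      (by rwa [openTriangle_swap]) hj hvj ⟨β, γ, hβ, hγ, by linarith, by simp⟩
  · exact hside i j hij hp.ne' hT hi hvi ⟨α, γ, hα, hγ, by linarith, by simp⟩
  · exact Set.disjoint_left.1 hdT hx ⟨α, β, γ, hα, hβ, hγ, h, rfl⟩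

lemma subset_interior_of_disjoint_edges {n : ℕ} (SP : SimplePolygon n) {S : Set Plane}
    (hS : IsPreconnected S) (hd : ∀ m, Disjoint (SP.edge m) S)
    (hne : (S ∩ interior SP.P).Nonempty) : S ⊆ interior SP.P := by
  refine hS.subset_interior_of_disjoint_frontier SP.isClosed (Set.disjoint_left.2 ?_) hne
  intro x hx hx'
  obtain ⟨m, hm⟩ := SP.exists_mem_edge hx'
  exact Set.disjoint_left.1 (hd m) hm hx

/-- The apex of a free triangle that contains no vertex apart from its base can be moved both ways
along some line. -/
lemma exists_direction {n : ℕ} (SP : SimplePolygon n) {i j : ZMod n} (hij : i ≠ j)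
    (hfree : SP.IsFree i j) {p : Plane} (hp : 0 < cross (SP.v i) (SP.v j) p)
    (hT : openTriangle (SP.v i) (SP.v j) p ⊆ interior SP.P)
    (hvert : ∀ r, SP.v r ∈ convexHull ℝ {SP.v i, SP.v j, p} → r = i ∨ r = j) :
    ∃ d : Plane, d ≠ 0 ∧ ∀ᶠ t : ℝ in 𝓝 0,
      openTriangle (SP.v i) (SP.v j) (p + t • d) ⊆ interior SP.P := by
  have : NeZero n := ⟨by have := SP.three_le; omega⟩
  have hpv : ∀ r, p ≠ SP.v r := by
    rintro r rfl
    have : cross (SP.v i) (SP.v j) (SP.v r) = 0 := by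
      rcases hvert r (subset_convexHull ℝ _ (by simp)) with rfl | rfl <;> simp only [cross] <;> ring
    linarith
  obtain ⟨d, hd, hall⟩ : ∃ d : Plane, d ≠ 0 ∧ ∀ m, ∀ᶠ t : ℝ in 𝓝 0,
      Disjoint (SP.edge m) (openTriangle (SP.v i) (SP.v j) (p + t • d)) := by
    have hcont : ∀ d : Plane, Tendsto (fun t : ℝ => p + t • d) (𝓝 0) (𝓝 p) := fun d => by
      have : Continuous fun t : ℝ => p + t • d := by fun_prop
      simpa using this.tendsto 0
    by_cases hex : ∃ m, p ∈ SP.edge m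
    · obtain ⟨m, hm⟩ := hex
      refine ⟨SP.v (m + 1) - SP.v m, ?_, fun l => ?_⟩
      · rw [sub_ne_zero]
        exact fun h => SP.ne_add_one m (SP.inj h).symm
      · by_cases hl : l = m
        · subst hl
          exact Eventually.of_forall fun t => disjoint_openTriangle_slide hp.ne'
            (SP.disjoint_edge_of_subset_interior l hT) (SP.mem_openSegment_of_mem_edge hm hpv) t
        · refine (hcont _).eventually (SP.eventually_disjoint_edge hij hfree hp hT hvert l ?_)
          intro hpl
          obtain ⟨r, hr⟩ := SP.exists_vertex_of_mem_edges hl hpl hm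
          exact hpv r hr
    · push Not at hex
      exact ⟨(1, 0), by simp, fun l => (hcont _).eventually
        (SP.eventually_disjoint_edge hij hfree hp hT hvert l (hex l))⟩
  refine ⟨d, hd, ?_⟩
  have hbary : ∀ᶠ t : ℝ in 𝓝 0,
      (1 / 3 : ℝ) • SP.v i + (1 / 3 : ℝ) • SP.v j + (1 / 3 : ℝ) • (p + t • d) ∈
        interior SP.P := by
    have : Continuous fun t : ℝ =>
      (1 / 3 : ℝ) • SP.v i + (1 / 3 : ℝ) • SP.v j + (1 / 3 : ℝ) • (p + t • d) := by fun_prop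
    refine (this.tendsto 0).eventually (isOpen_interior.mem_nhds ?_)
    rw [zero_smul, add_zero]
    exact hT ⟨1 / 3, 1 / 3, 1 / 3, by norm_num, by norm_num, by norm_num, by norm_num, rfl⟩
  filter_upwards [eventually_all.2 hall, hbary] with t h1 h2
  exact SP.subset_interior_of_disjoint_edges (convex_openTriangle _ _ _).isPreconnected h1
    ⟨_, ⟨1 / 3, 1 / 3, 1 / 3, by norm_num, by norm_num, by norm_num, by norm_num, rfl⟩, h2⟩

/-- If some triangle over the base `v i, v j` is free, then so is one whose apex is a vertex on
the same side. -/
lemma exists_vertex_openTriangle_subset {n : ℕ} (SP : SimplePolygon n) {i j : ZMod n}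
    (hij : i ≠ j) (hfree : SP.IsFree i j) {p₀ : Plane} (hp₀ : 0 < cross (SP.v i) (SP.v j) p₀)
    (hT₀ : openTriangle (SP.v i) (SP.v j) p₀ ⊆ interior SP.P) :
    ∃ r, 0 < cross (SP.v i) (SP.v j) (SP.v r) ∧
      openTriangle (SP.v i) (SP.v j) (SP.v r) ⊆ interior SP.P := by
  by_contra! hcon
  set a := SP.v i
  set b := SP.v j
  have hab : b - a ≠ 0 := sub_ne_zero.2 fun h => hij (SP.inj h).symm
  set S : Set Plane := {p | cross a b p₀ ≤ cross a b p ∧ openTriangle a b p ⊆ SP.P} with hS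
  have hSP : S ⊆ SP.P := fun p hp => by
    have := mem_closure_openTriangle a b p le_rfl le_rfl zero_le_one (by norm_num)
    rw [zero_smul, zero_smul, one_smul, zero_add, zero_add] at this
    exact closure_minimal hp.2 SP.isClosed this
  have hSclosed : IsClosed S := by
    have : S = {p | cross a b p₀ ≤ cross a b p} ∩ ⋂ (α : ℝ) (β : ℝ) (γ : ℝ) (_ : 0 < α)
        (_ : 0 < β) (_ : 0 < γ) (_ : α + β + γ = 1), {p | α • a + β • b + γ • p ∈ SP.P} := by
      ext p
      simp only [hS, mem_inter_iff, mem_iInter, mem_ofPred_eq]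
      refine and_congr_right fun _ => ⟨fun h α β γ hα hβ hγ hs => h ⟨α, β, γ, hα, hβ, hγ, hs, rfl⟩,
        ?_⟩
      rintro h _ ⟨α, β, γ, hα, hβ, hγ, hs, rfl⟩
      exact h α β γ hα hβ hγ hs
    rw [this]
    refine (isClosed_le continuous_const (continuous_cross a b)).inter ?_
    refine isClosed_iInter fun α => isClosed_iInter fun β => isClosed_iInter fun γ =>
      isClosed_iInter fun _ => isClosed_iInter fun _ => isClosed_iInter fun _ =>
      isClosed_iInter fun _ => SP.isClosed.preimage (by fun_prop)
  have hScomp : IsCompact S := SP.compact.of_isClosed_subset hSclosed hSP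
  obtain ⟨p₁, hp₁, hmax₁⟩ := hScomp.exists_isMaxOn
    ⟨p₀, le_rfl, hT₀.trans interior_subset⟩ (continuous_cross a b).continuousOn
  have hlin : Continuous fun p : Plane => (b.1 - a.1) * p.1 + (b.2 - a.2) * p.2 := by fun_prop
  obtain ⟨p, ⟨hpS, hp1⟩, hmax₂⟩ := (hScomp.inter_right
    (isClosed_eq (continuous_cross a b) (continuous_const (y := cross a b p₁)))).exists_isMaxOn
    ⟨p₁, hp₁, rfl⟩ hlin.continuousOn
  have hp1 : cross a b p = cross a b p₁ := hp1
  have hp : 0 < cross a b p := hp₀.trans_le hpS.1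
  have hT : openTriangle a b p ⊆ interior SP.P :=
    interior_maximal hpS.2 (isOpen_openTriangle hp.ne')
  have hvert : ∀ r, SP.v r ∈ convexHull ℝ {a, b, p} → r = i ∨ r = j := by
    intro r hr
    obtain ⟨α, β, γ, hα, hβ, hγ, h, he⟩ := exists_of_mem_convexHull_triple hr
    rcases hγ.eq_or_lt with rfl | hγ
    · exact SP.eq_or_eq_of_mem_segment hij ⟨α, β, hα, hβ, by linarith, by simp [he, a, b]⟩
    · exfalso
      refine hcon r ?_ ?_
      · rw [he, cross_combination a b p h]
        positivity
      · rw [he]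
        exact (openTriangle_subset_openTriangle a b p hα hβ hγ h).trans hT
  obtain ⟨d, hd, hev⟩ := SP.exists_direction hij hfree hp hT hvert
  obtain ⟨ε, hε, hball⟩ := Metric.eventually_nhds_iff.1 hev
  have hmem : ∀ t : ℝ, |t| < ε → openTriangle a b (p + t • d) ⊆ SP.P := fun t ht =>
    (hball (by simpa using ht)).trans interior_subset
  have hcr : ∀ t : ℝ, cross a b (p + t • d) = cross a b p +
      t * ((b.1 - a.1) * d.2 - (b.2 - a.2) * d.1) := fun t => by
    simp only [cross, Prod.fst_add, Prod.snd_add, Prod.smul_fst, Prod.smul_snd, smul_eq_mul]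
    ring
  set κ := (b.1 - a.1) * d.2 - (b.2 - a.2) * d.1 with hκ
  have hle : ∀ t : ℝ, |t| < ε → t * κ ≤ 0 := by
    intro t ht
    by_contra! hpos
    have : p + t • d ∈ S := ⟨by rw [hcr]; linarith [hpS.1], hmem t ht⟩
    have : cross a b (p + t • d) ≤ cross a b p₁ := hmax₁ this
    rw [hcr] at this
    linarith
  have hε1 : |ε / 2| < ε := by rw [abs_of_pos (by positivity)]; linarith
  have hε2 : |-(ε / 2)| < ε := by rwa [abs_neg]
  have hκ0 : κ = 0 := by
    have h1 := hle _ hε1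
    have h2 := hle _ hε2
    have h3 : ε / 2 * κ = 0 := by linarith
    exact (mul_eq_zero.1 h3).resolve_left (by positivity)
  have hle' : ∀ t : ℝ, |t| < ε → t * ((b.1 - a.1) * d.1 + (b.2 - a.2) * d.2) ≤ 0 := by
    intro t ht
    have hcr' : cross a b (p + t • d) = cross a b p := by rw [hcr, hκ0, mul_zero, add_zero]
    have h1 : p + t • d ∈ S ∩ {x | cross a b x = cross a b p₁} :=
      ⟨⟨by rw [hcr']; exact hpS.1, hmem t ht⟩, hcr'.trans hp1⟩
    have h2 : (b.1 - a.1) * (p + t • d).1 + (b.2 - a.2) * (p + t • d).2 ≤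
      (b.1 - a.1) * p.1 + (b.2 - a.2) * p.2 := hmax₂ h1
    simp only [Prod.fst_add, Prod.snd_add, Prod.smul_fst, Prod.smul_snd, smul_eq_mul] at h2
    linarith
  have hμ0 : (b.1 - a.1) * d.1 + (b.2 - a.2) * d.2 = 0 := by
    have h1 := hle' _ hε1
    have h2 := hle' _ hε2
    have h3 : ε / 2 * ((b.1 - a.1) * d.1 + (b.2 - a.2) * d.2) = 0 := by linarith
    exact (mul_eq_zero.1 h3).resolve_left (by positivity)
  have hnorm : ((b.1 - a.1) ^ 2 + (b.2 - a.2) ^ 2) * (d.1 ^ 2 + d.2 ^ 2) = 0 := by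
    linear_combination κ * hκ0 + ((b.1 - a.1) * d.1 + (b.2 - a.2) * d.2) * hμ0
  rcases mul_eq_zero.1 hnorm with h | h
  · apply hab
    ext
    · simp only [Prod.fst_sub, Prod.fst_zero]
      nlinarith [sq_nonneg (b.1 - a.1), sq_nonneg (b.2 - a.2)]
    · simp only [Prod.snd_sub, Prod.snd_zero]
      nlinarith [sq_nonneg (b.1 - a.1), sq_nonneg (b.2 - a.2)]
  · apply hd
    ext
    · simp only [Prod.fst_zero]
      nlinarith [sq_nonneg d.1, sq_nonneg d.2]
    · simp only [Prod.snd_zero]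
      nlinarith [sq_nonneg d.1, sq_nonneg d.2]

end SimplePolygon

lemma cross_add_smul_normal (a b x : Plane) (t : ℝ) :
    cross a b (x + t • ((-(b.2 - a.2), b.1 - a.1) : Plane)) =
      cross a b x + t * ((b.1 - a.1) ^ 2 + (b.2 - a.2) ^ 2) := by
  simp only [cross, Prod.fst_add, Prod.snd_add, Prod.smul_fst, Prod.smul_snd, smul_eq_mul]
  ring

lemma sq_add_sq_pos_of_ne {a b : Plane} (hab : a ≠ b) :
    0 < (b.1 - a.1) ^ 2 + (b.2 - a.2) ^ 2 := by
  by_contra! h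
  apply hab
  ext <;> nlinarith [sq_nonneg (b.1 - a.1), sq_nonneg (b.2 - a.2)]

lemma frequently_cross_pos {a b q : Plane} {U : Set Plane} (hab : a ≠ b) (hU : U ∈ 𝓝 q)
    (hq : cross a b q = 0) : ∃ᶠ x in 𝓝 q, x ∈ U ∧ 0 < cross a b x := by
  have hlim : Tendsto (fun t : ℝ => q + t • ((-(b.2 - a.2), b.1 - a.1) : Plane)) (𝓝[>] 0)
      (𝓝 q) := by
    have : Continuous fun t : ℝ => q + t • ((-(b.2 - a.2), b.1 - a.1) : Plane) := by fun_prop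
    simpa using (this.tendsto 0).mono_left nhdsWithin_le_nhds
  refine hlim.frequently (Eventually.frequently ?_)
  filter_upwards [hlim.eventually hU, self_mem_nhdsWithin] with t ht ht0
  refine ⟨ht, ?_⟩
  rw [cross_add_smul_normal, hq, zero_add]
  exact mul_pos ht0 (sq_add_sq_pos_of_ne hab)

lemma frequently_cross_ne_zero {a b q : Plane} {U : Set Plane} (hab : a ≠ b) (hU : IsOpen U)
    (hq : q ∈ closure U) : ∃ᶠ x in 𝓝 q, x ∈ U ∧ cross a b x ≠ 0 := by
  have hsub : U ⊆ closure {x | x ∈ U ∧ cross a b x ≠ 0} := by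
    intro x hx
    by_cases h : cross a b x = 0
    · exact mem_closure_iff_frequently.2
        ((frequently_cross_pos hab (hU.mem_nhds hx) h).mono fun y hy => ⟨hy.1, hy.2.ne'⟩)
    · exact subset_closure ⟨hx, h⟩
  exact mem_closure_iff_frequently.1 (closure_minimal hsub isClosed_closure hq)

lemma cross_convex_combination (a b x y : Plane) {s t : ℝ} (h : s + t = 1) :
    cross a b (s • x + t • y) = s * cross a b x + t * cross a b y := by
  obtain rfl : s = 1 - t := by linarith
  simp only [cross, Prod.fst_add, Prod.snd_add, Prod.smul_fst, Prod.smul_snd, smul_eq_mul]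
  ring

lemma cross_eq_zero_of_mem_segment {a b x : Plane} (h : x ∈ segment ℝ a b) :
    cross a b x = 0 := by
  obtain ⟨s, t, hs, ht, hst, rfl⟩ := h
  rw [cross_convex_combination a b a b hst]
  simp only [cross]; ring

namespace SimplePolygon

lemma eventually_disjoint_thin {n : ℕ} (SP : SimplePolygon n) {i j : ZMod n} (hij : i ≠ j)
    (hfree : SP.IsFree i j) {q : Plane} (hq : q ∈ openSegment ℝ (SP.v i) (SP.v j)) (m : ZMod n) :
    ∀ᶠ p in 𝓝 q, cross (SP.v i) (SP.v j) p ≠ 0 →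
      Disjoint (SP.edge m) (openTriangle (SP.v i) (SP.v j) p) := by
  rcases hfree m with hd | hsub
  swap
  · refine Eventually.of_forall fun p hp => Set.disjoint_left.2 ?_
    rintro x hx ⟨α, β, γ, hα, hβ, hγ, h, rfl⟩
    obtain ⟨s, t, hs, ht, hst, he⟩ := hsub hx
    have h2 := cross_combination (SP.v i) (SP.v j) p (α := s) (β := t) (γ := 0) (by linarith)
    rw [zero_smul, add_zero, zero_mul, he, cross_combination _ _ _ h] at h2
    exact mul_ne_zero hγ.ne' hp h2
  have hbase : ∀ k l : ZMod n, k ≠ l →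
      Disjoint (SP.edge m) (openSegment ℝ (SP.v k) (SP.v l)) →
      q ∈ openSegment ℝ (SP.v k) (SP.v l) → SP.v k ∈ SP.edge m →
      ∀ᶠ p in 𝓝 q, Disjoint (SP.edge m) (openTriangle (SP.v k) (SP.v l) p) := by
    intro k l hkl hd hq hk
    obtain ⟨r, hrk, hrl, hr⟩ := SP.exists_edge_eq_segment hkl hd hk
    rw [hr]
    exact eventually_disjoint_thin_openTriangle (SP.cross_ne_zero hkl hrk.symm hrl.symm) hq
  by_cases hi : SP.v i ∈ SP.edge m
  · exact (hbase i j hij hd hq hi).mono fun p hp _ => hp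
  by_cases hj : SP.v j ∈ SP.edge m
  · refine (hbase j i hij.symm (by rwa [openSegment_symm]) (by rwa [openSegment_symm]) hj).mono
      fun p hp _ => ?_
    rwa [openTriangle_swap] at hp
  refine (eventually_disjoint_openTriangle_of_disjoint (isCompact_segment _ _)
    (convex_segment _ _) (Set.disjoint_left.2 fun x hx hx' => ?_)).mono fun p hp _ => hp
  have hsub : convexHull ℝ {SP.v i, SP.v j, q} ⊆ segment ℝ (SP.v i) (SP.v j) := by
    refine convexHull_min ?_ (convex_segment _ _)
    rintro y (rfl | rfl | rfl)
    · exact left_mem_segment ℝ _ _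
    · exact right_mem_segment ℝ _ _
    · exact openSegment_subset_segment ℝ _ _ hq
  refine Set.disjoint_left.1 hd hx (mem_openSegment_of_ne_left_right ?_ ?_ (hsub hx'))
  · rintro rfl; exact hi hx
  · rintro rfl; exact hj hx

/-- If interior points accumulate at an inner point of the base from the left side, then there is
a vertex on this side whose triangle over the base is free. -/
lemma exists_vertex_of_frequently {n : ℕ} (SP : SimplePolygon n) {i j : ZMod n}
    (hij : i ≠ j) (hfree : SP.IsFree i j) {q : Plane}
    (hq : q ∈ openSegment ℝ (SP.v i) (SP.v j))
    (hfreq : ∃ᶠ x in 𝓝 q, x ∈ interior SP.P ∧ 0 < cross (SP.v i) (SP.v j) x) :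
    ∃ r, 0 < cross (SP.v i) (SP.v j) (SP.v r) ∧
      openTriangle (SP.v i) (SP.v j) (SP.v r) ⊆ interior SP.P := by
  have : NeZero n := ⟨by have := SP.three_le; omega⟩
  have hlim : Tendsto (fun x : Plane => q + (2 : ℝ) • (x - q)) (𝓝 q) (𝓝 q) := by
    have : Continuous fun x : Plane => q + (2 : ℝ) • (x - q) := by fun_prop
    simpa using this.tendsto q
  obtain ⟨x, ⟨hxP, hx⟩, hall⟩ := (hfreq.and_eventually
    (hlim.eventually (eventually_all.2 (SP.eventually_disjoint_thin hij hfree hq)))).exists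
  obtain ⟨s, t, hs, ht, hst, rfl⟩ := hq
  set a := SP.v i
  set b := SP.v j
  set p := (s • a + t • b) + (2 : ℝ) • (x - (s • a + t • b)) with hp
  have hxp : x = (s / 2) • a + (t / 2) • b + (1 / 2 : ℝ) • p := by
    rw [hp]; module
  have hsum : s / 2 + t / 2 + 1 / 2 = 1 := by linarith
  have hcp : 0 < cross a b p := by
    rw [hxp, cross_combination a b p hsum] at hx
    linarith
  refine SP.exists_vertex_openTriangle_subset hij hfree hcp
    (SP.subset_interior_of_disjoint_edges (convex_openTriangle _ _ _).isPreconnected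
      (fun m => hall m hcp.ne') ⟨x, ?_, hxP⟩)
  exact ⟨s / 2, t / 2, 1 / 2, by positivity, by positivity, by norm_num, hsum, hxp⟩

lemma not_mem_openSegment_of_mem_openSegment {n : ℕ} (SP : SimplePolygon n) {k l r : ZMod n}
    (hkl : k ≠ l) (hkr : k ≠ r) (hlr : l ≠ r) {x : Plane}
    (h : x ∈ openSegment ℝ (SP.v k) (SP.v l)) : x ∉ openSegment ℝ (SP.v k) (SP.v r) := by
  rintro ⟨s, t, hs, ht, hst, rfl⟩
  obtain ⟨s', t', hs', ht', hst', he⟩ := h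
  have h1 := cross_combination (SP.v k) (SP.v l) (SP.v r) (α := s) (β := 0) (γ := t) (by linarith)
  have h2 := cross_combination (SP.v k) (SP.v l) (SP.v r) (α := s') (β := t') (γ := 0)
    (by linarith)
  rw [zero_smul, add_zero] at h1
  rw [zero_smul, add_zero, zero_mul, he, h1] at h2
  exact mul_ne_zero ht.ne' (SP.cross_ne_zero hkl hkr hlr) h2

/-- A segment inside the polygon does not cross an edge transversally. -/
lemma not_crossing {n : ℕ} (SP : SimplePolygon n) {m : ZMod n} {a b x : Plane}
    (hvis : segment ℝ a b ⊆ SP.P) (hxab : x ∈ segment ℝ a b) (hxm : x ∈ SP.edge m)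
    (hxv : ∀ r, x ≠ SP.v r) (ha : 0 < cross (SP.v m) (SP.v (m + 1)) a)
    (hb : cross (SP.v m) (SP.v (m + 1)) b < 0) : False := by
  have : NeZero n := ⟨by have := SP.three_le; omega⟩
  set c := SP.v m
  set d := SP.v (m + 1)
  have hcx : cross c d x = 0 := cross_eq_zero_of_mem_segment hxm
  have hnear : ∀ᶠ y in 𝓝 x, ∀ l, l ≠ m → y ∉ SP.edge l := by
    refine eventually_all.2 fun l => ?_
    by_cases hl : l = m
    · exact Eventually.of_forall fun y h => absurd hl h
    · have hxl : x ∉ SP.edge l := fun hxl => by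
        obtain ⟨r, hr⟩ := SP.exists_vertex_of_mem_edges hl hxl hxm
        exact hxv r hr
      have hopen : IsOpen (SP.edge l)ᶜ := (isCompact_segment _ _).isClosed.isOpen_compl
      filter_upwards [hopen.mem_nhds hxl] with y hy _ using hy
  obtain ⟨ε, hε, hball⟩ := Metric.eventually_nhds_iff_ball.1 hnear
  set B := Metric.ball x ε
  have hB : Convex ℝ B := convex_ball x ε
  have hoff : ∀ y ∈ B, cross c d y ≠ 0 → y ∉ frontier SP.P := by
    intro y hy hcy hyf
    obtain ⟨l, hl⟩ := SP.exists_mem_edge hyf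
    by_cases hlm : l = m
    · subst hlm
      exact hcy (cross_eq_zero_of_mem_segment hl)
    · exact hball y hy l hlm hl
  have hmove : ∀ y ∈ B, ∀ e : Plane, ∀ᶠ t : ℝ in 𝓝[>] 0, y + t • e ∈ B := by
    intro y hy e
    have : Continuous fun t : ℝ => y + t • e := by fun_prop
    have h0 : Tendsto (fun t : ℝ => y + t • e) (𝓝[>] 0) (𝓝 y) := by
      simpa using (this.tendsto 0).mono_left nhdsWithin_le_nhds
    exact h0.eventually (Metric.isOpen_ball.mem_nhds hy)
  have hhalf : ∀ e ∈ segment ℝ a b, ∀ C : Set Plane, Convex ℝ C →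
      (∀ y ∈ C, cross c d y ≠ 0) → (∀ t : ℝ, 0 < t → x + t • (e - x) ∈ C) →
      B ∩ C ⊆ interior SP.P := by
    intro e he C hC hC0 hCe
    refine (hB.inter hC).isPreconnected.subset_interior_of_disjoint_frontier SP.isClosed
      (Set.disjoint_left.2 fun y hy => hoff y hy.1 (hC0 y hy.2)) ?_
    have hle : ∀ᶠ t : ℝ in 𝓝[>] 0, t < 1 :=
      nhdsWithin_le_nhds (Iio_mem_nhds zero_lt_one)
    obtain ⟨t, ht, ht1, ht0⟩ := ((hmove x (Metric.mem_ball_self hε) (e - x)).and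
      (hle.and self_mem_nhdsWithin)).exists
    have ht0 : 0 < t := ht0
    have hmem : x + t • (e - x) ∈ SP.P := hvis ((convex_segment a b).add_smul_sub_mem hxab he
      ⟨ht0.le, ht1.le⟩)
    refine ⟨_, ⟨ht, hCe t ht0⟩, ?_⟩
    by_contra hni
    exact hoff _ ht (hC0 _ (hCe t ht0)) (SP.isClosed.frontier_eq ▸ ⟨hmem, hni⟩)
  have hce : ∀ (y e : Plane) (t : ℝ), cross c d (y + t • (e - x)) =
      cross c d y + t * cross c d e := by
    intro y e t
    have h1 : cross c d (y + t • (e - x)) =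
        cross c d y + t * cross c d e - t * cross c d x := by
      simp only [cross, Prod.fst_add, Prod.snd_add, Prod.smul_fst, Prod.smul_snd, smul_eq_mul,
        Prod.fst_sub, Prod.snd_sub]
      ring
    rw [h1, hcx, mul_zero, sub_zero]
  have hpos : B ∩ {y | 0 < cross c d y} ⊆ interior SP.P := by
    refine hhalf a (left_mem_segment ℝ a b) _ ?_ (fun y hy => ne_of_gt hy) fun t ht => ?_
    · intro y hy z hz s t hs ht hst
      have hy : 0 < cross c d y := hy
      have hz : 0 < cross c d z := hz
      change 0 < cross c d _
      rw [cross_convex_combination c d y z hst]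
      rcases hs.eq_or_lt with rfl | hs
      · obtain rfl : t = 1 := by linarith
        simpa using hz
      · have := mul_pos hs hy
        have := mul_nonneg ht hz.le
        linarith
    · change 0 < cross c d _
      rw [hce, hcx, zero_add]
      positivity
  have hneg : B ∩ {y | cross c d y < 0} ⊆ interior SP.P := by
    refine hhalf b (right_mem_segment ℝ a b) _ ?_ (fun y hy => ne_of_lt hy) fun t ht => ?_
    · intro y hy z hz s t hs ht hst
      have hy : cross c d y < 0 := hy
      have hz : cross c d z < 0 := hz
      change cross c d _ < 0
      rw [cross_convex_combination c d y z hst]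
      rcases hs.eq_or_lt with rfl | hs
      · obtain rfl : t = 1 := by linarith
        simpa using hz
      · have := mul_neg_of_pos_of_neg hs hy
        have := mul_nonpos_of_nonneg_of_nonpos ht hz.le
        linarith
    · change cross c d _ < 0
      rw [hce, hcx, zero_add]
      exact mul_neg_of_pos_of_neg ht hb
  have hBP : B ⊆ SP.P := by
    intro y hy
    rcases lt_trichotomy (cross c d y) 0 with h | h | h
    · exact interior_subset (hneg ⟨hy, h⟩)
    · have hc : Continuous fun t : ℝ => y + t • (a - x) := by fun_prop
      have hlim : Tendsto (fun t : ℝ => y + t • (a - x)) (𝓝[>] 0) (𝓝 y) := by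
        simpa using (hc.tendsto 0).mono_left nhdsWithin_le_nhds
      refine SP.isClosed.mem_of_tendsto hlim ?_
      filter_upwards [hmove y hy (a - x), self_mem_nhdsWithin] with t ht ht0
      refine interior_subset (hpos ⟨ht, ?_⟩)
      change 0 < cross c d _
      rw [hce, h, zero_add]
      exact mul_pos ht0 ha
    · exact interior_subset (hpos ⟨hy, h⟩)
  exact (SP.edge_subset_frontier m hxm).2
    (interior_maximal hBP Metric.isOpen_ball (Metric.mem_ball_self hε))

/-- An inner point of a diagonal is not a vertex. -/
lemma ne_vertex_of_mem_openSegment {n : ℕ} (SP : SimplePolygon n) {i j : ZMod n} (hij : i ≠ j)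
    {x : Plane} (hx : x ∈ openSegment ℝ (SP.v i) (SP.v j)) (r : ZMod n) : x ≠ SP.v r := by
  rintro rfl
  rcases SP.eq_or_eq_of_mem_segment hij (openSegment_subset_segment ℝ _ _ hx) with rfl | rfl
  · exact hij (SP.inj (left_mem_openSegment_iff.1 hx))
  · exact hij (SP.inj (right_mem_openSegment_iff.1 hx))

/-- A diagonal inside the polygon that is not an edge has no inner point on the boundary. -/
lemma disjoint_edge_of_visible {n : ℕ} (SP : SimplePolygon n) {i j : ZMod n} (hij : i ≠ j)
    (h1 : j ≠ i + 1) (h2 : i ≠ j + 1) (hvis : Visible SP.P (SP.v i) (SP.v j)) (m : ZMod n) :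
    Disjoint (SP.edge m) (openSegment ℝ (SP.v i) (SP.v j)) := by
  rw [Set.disjoint_left]
  intro x hxm hx
  have hxv := SP.ne_vertex_of_mem_openSegment hij hx
  have hxo := SP.mem_openSegment_of_mem_edge hxm hxv
  have hx' : x ∈ openSegment ℝ (SP.v j) (SP.v i) := by rwa [openSegment_symm]
  have hxo' : x ∈ openSegment ℝ (SP.v (m + 1)) (SP.v m) := by rwa [openSegment_symm]
  have him : i ≠ m := by
    rintro rfl
    exact SP.not_mem_openSegment_of_mem_openSegment hij (SP.ne_add_one i) h1 hx hxo
  have hjm : j ≠ m := by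
    rintro rfl
    exact SP.not_mem_openSegment_of_mem_openSegment hij.symm (SP.ne_add_one j) h2 hx' hxo
  have him' : i ≠ m + 1 := by
    rintro rfl
    exact SP.not_mem_openSegment_of_mem_openSegment hij (SP.ne_add_one m).symm hjm hx hxo'
  have hjm' : j ≠ m + 1 := by
    rintro rfl
    exact SP.not_mem_openSegment_of_mem_openSegment hij.symm (SP.ne_add_one m).symm him hx' hxo'
  have hci := SP.cross_ne_zero (SP.ne_add_one m) him.symm him'.symm
  have hcj := SP.cross_ne_zero (SP.ne_add_one m) hjm.symm hjm'.symm
  have hseg := openSegment_subset_segment ℝ _ _ hx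
  have hzero : cross (SP.v m) (SP.v (m + 1)) x = 0 := cross_eq_zero_of_mem_segment hxm
  obtain ⟨s, t, hs, ht, hst, he⟩ := id hx
  rw [← he, cross_convex_combination _ _ _ _ hst] at hzero
  rcases hci.lt_or_gt with h | h
  · refine SP.not_crossing (a := SP.v j) (b := SP.v i) (by rwa [segment_symm])
      (by rwa [segment_symm]) hxm hxv ?_ h
    have := mul_neg_of_pos_of_neg hs h
    by_contra! hcon
    linarith [mul_nonpos_of_nonneg_of_nonpos ht.le hcon]
  · refine SP.not_crossing hvis hseg hxm hxv h ?_
    have := mul_pos hs h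
    by_contra! hcon
    linarith [mul_nonneg ht.le hcon]

/-- The endpoints of an edge span a free segment. -/
lemma isFree_of_add_one_eq {n : ℕ} (SP : SimplePolygon n) {i j : ZMod n} (h : i = j + 1) :
    SP.IsFree i j := by
  subst h
  intro m
  by_cases hm : m = j
  · subst hm
    right
    rw [segment_symm]
    exact Subset.rfl
  · left
    rw [Set.disjoint_left]
    intro x hxm hx
    have hxj : x ∈ SP.edge j := by
      rw [openSegment_symm] at hx
      exact openSegment_subset_segment ℝ _ _ hx
    obtain ⟨r, hr⟩ := SP.exists_vertex_of_mem_edges hm hxm hxj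
    exact SP.ne_vertex_of_mem_openSegment (SP.ne_add_one j).symm hx r hr

end SimplePolygon

/-- The signed angle under which the segment from `u` to `w` is seen from `p`. -/
noncomputable def viewAngle (u w p : Plane) : ℝ :=
  Complex.arg ((Complex.equivRealProdCLM.symm w - Complex.equivRealProdCLM.symm p) /
    (Complex.equivRealProdCLM.symm u - Complex.equivRealProdCLM.symm p))

/-- The total angle of the closed polygonal line `V 0, …, V k` as seen from `p`. -/
noncomputable def windingAngle (V : ℕ → Plane) (k : ℕ) (p : Plane) : ℝ :=
  ∑ t ∈ Finset.range k, viewAngle (V t) (V (t + 1)) p + viewAngle (V k) (V 0) p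

lemma viewRatio_ne_zero {u p : Plane} (h : p ≠ u) :
    Complex.equivRealProdCLM.symm u - Complex.equivRealProdCLM.symm p ≠ 0 :=
  sub_ne_zero.2 fun h' => h (Complex.equivRealProdCLM.symm.injective h').symm

lemma viewRatio_mem_slitPlane {u w p : Plane} (h : p ∉ segment ℝ u w) :
    (Complex.equivRealProdCLM.symm w - Complex.equivRealProdCLM.symm p) /
      (Complex.equivRealProdCLM.symm u - Complex.equivRealProdCLM.symm p) ∈
        Complex.slitPlane := by
  by_contra hcon
  have hu : p ≠ u := by rintro rfl; exact h (left_mem_segment ℝ _ _)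
  have hu0 := viewRatio_ne_zero hu
  rw [Complex.mem_slitPlane_iff_not_le_zero, not_not, Complex.le_def] at hcon
  obtain ⟨hre, him⟩ := hcon
  set z := (Complex.equivRealProdCLM.symm w - Complex.equivRealProdCLM.symm p) /
      (Complex.equivRealProdCLM.symm u - Complex.equivRealProdCLM.symm p) with hz
  rw [eq_div_iff hu0] at hz
  have hzr : z = (z.re : ℂ) := Complex.ext (by simp) (by simpa using him)
  rw [hzr, ← Complex.real_smul, ← map_sub, ← map_sub, ← map_smul] at hz
  have hz' : z.re • (u - p) = w - p := Complex.equivRealProdCLM.symm.injective hz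
  have hre : z.re ≤ 0 := hre
  have hpos : 0 < 1 - z.re := by linarith
  refine h ⟨-z.re / (1 - z.re), 1 / (1 - z.re), by apply div_nonneg <;> linarith, by positivity,
    by field_simp; ring, ?_⟩
  have hw : w = p + z.re • (u - p) := by rw [hz']; abel
  rw [hw]
  ext
  · simp only [Prod.fst_add, Prod.smul_fst, Prod.fst_sub, smul_eq_mul]
    field_simp; ring
  · simp only [Prod.snd_add, Prod.smul_snd, Prod.snd_sub, smul_eq_mul]
    field_simp; ring

lemma continuousAt_viewRatio {u p : Plane} (w : Plane) (h : p ≠ u) :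
    ContinuousAt (fun x => (Complex.equivRealProdCLM.symm w - Complex.equivRealProdCLM.symm x) /
      (Complex.equivRealProdCLM.symm u - Complex.equivRealProdCLM.symm x)) p := by
  refine ContinuousAt.div ?_ ?_ (viewRatio_ne_zero h) <;> fun_prop

lemma continuousAt_viewAngle {u w p : Plane} (h : p ∉ segment ℝ u w) :
    ContinuousAt (viewAngle u w) p :=
  ContinuousAt.comp (g := Complex.arg) (Complex.continuousAt_arg (viewRatio_mem_slitPlane h))
    (continuousAt_viewRatio w fun hp => h (hp.symm ▸ left_mem_segment ℝ u w))

lemma exp_viewAngle {u w p : Plane} (hu : p ≠ u) (hw : p ≠ w) :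
    Complex.exp (viewAngle u w p * Complex.I) *
        ((Complex.equivRealProdCLM.symm u - Complex.equivRealProdCLM.symm p) /
          ‖Complex.equivRealProdCLM.symm u - Complex.equivRealProdCLM.symm p‖) =
      (Complex.equivRealProdCLM.symm w - Complex.equivRealProdCLM.symm p) /
          ‖Complex.equivRealProdCLM.symm w - Complex.equivRealProdCLM.symm p‖ := by
  have hu0 := viewRatio_ne_zero hu
  have hw0 := viewRatio_ne_zero hw
  have h := Complex.norm_mul_exp_arg_mul_I
    ((Complex.equivRealProdCLM.symm w - Complex.equivRealProdCLM.symm p) /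
      (Complex.equivRealProdCLM.symm u - Complex.equivRealProdCLM.symm p))
  unfold viewAngle
  have hu1 : ((‖Complex.equivRealProdCLM.symm u - Complex.equivRealProdCLM.symm p‖ : ℝ) : ℂ) ≠ 0 :=
    Complex.ofReal_ne_zero.2 (norm_ne_zero_iff.2 hu0)
  have hw1 : ((‖Complex.equivRealProdCLM.symm w - Complex.equivRealProdCLM.symm p‖ : ℝ) : ℂ) ≠ 0 :=
    Complex.ofReal_ne_zero.2 (norm_ne_zero_iff.2 hw0)
  rw [norm_div, Complex.ofReal_div] at h
  generalize Complex.exp _ = E at h ⊢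
  field_simp at h ⊢
  linear_combination h

/-- Outside its vertices, the total angle of a closed polygonal line is a multiple of `2π`. -/
lemma exists_windingAngle_eq {V : ℕ → Plane} {k : ℕ} {p : Plane} (h : ∀ t ≤ k, p ≠ V t) :
    ∃ m : ℤ, windingAngle V k p = m * (2 * Real.pi) := by
  have hsum : ∀ l ≤ k, Complex.exp (((∑ t ∈ Finset.range l, viewAngle (V t) (V (t + 1)) p : ℝ) : ℂ)
      * Complex.I) * ((Complex.equivRealProdCLM.symm (V 0) - Complex.equivRealProdCLM.symm p) /
          ‖Complex.equivRealProdCLM.symm (V 0) - Complex.equivRealProdCLM.symm p‖) =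
      (Complex.equivRealProdCLM.symm (V l) - Complex.equivRealProdCLM.symm p) /
          ‖Complex.equivRealProdCLM.symm (V l) - Complex.equivRealProdCLM.symm p‖ := by
    intro l
    induction l with
    | zero => simp
    | succ l ih =>
      intro hl
      rw [Finset.sum_range_succ, Complex.ofReal_add, add_mul, Complex.exp_add, mul_right_comm,
        ih (by omega), mul_comm]
      exact exp_viewAngle (h l (by omega)) (h (l + 1) hl)
  have h0 := h 0 (Nat.zero_le _)
  have hexp : Complex.exp ((windingAngle V k p : ℂ) * Complex.I) = 1 := by
    have h1 := exp_viewAngle (h k le_rfl) h0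
    rw [← hsum k le_rfl, ← mul_assoc, ← Complex.exp_add] at h1
    have hne : (Complex.equivRealProdCLM.symm (V 0) - Complex.equivRealProdCLM.symm p) /
        (‖Complex.equivRealProdCLM.symm (V 0) - Complex.equivRealProdCLM.symm p‖ : ℂ) ≠ 0 :=
      div_ne_zero (viewRatio_ne_zero h0)
        (Complex.ofReal_ne_zero.2 (norm_ne_zero_iff.2 (viewRatio_ne_zero h0)))
    rw [windingAngle, Complex.ofReal_add, add_mul, add_comm]
    exact (mul_eq_right₀ hne).1 h1
  obtain ⟨m, hm⟩ := Complex.exp_eq_one_iff.1 hexp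
  refine ⟨m, ?_⟩
  have hm' : (windingAngle V k p : ℂ) * Complex.I = (m * (2 * Real.pi) : ℂ) * Complex.I := by
    rw [hm]; ring
  exact_mod_cast mul_right_cancel₀ Complex.I_ne_zero hm'

lemma IsPreconnected.subsingleton_of_forall_exists_intCast {s : Set ℝ} (hs : IsPreconnected s)
    (h : ∀ x ∈ s, ∃ m : ℤ, x = m) : s.Subsingleton := by
  have key : ∀ x ∈ s, ∀ y ∈ s, ¬ x < y := by
    intro x hx y hy hlt
    obtain ⟨m, rfl⟩ := h x hx
    obtain ⟨l, rfl⟩ := h y hy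
    have hml : m + 1 ≤ l := by exact_mod_cast hlt
    have hml' : (m : ℝ) + 1 ≤ l := by exact_mod_cast hml
    obtain ⟨r, hr⟩ := h ((m : ℝ) + 1 / 2) (hs.ordConnected.out hx hy ⟨by linarith, by linarith⟩)
    have hr' : ((2 * m + 1 : ℤ) : ℝ) = (2 * r : ℤ) := by push_cast; linarith
    have := Int.cast_injective hr'
    omega
  intro x hx y hy
  exact le_antisymm (not_lt.1 (key y hy x hx)) (not_lt.1 (key x hx y hy))

lemma windingAngle_eq_of_isPreconnected {V : ℕ → Plane} {k : ℕ} {S : Set Plane}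
    (hS : IsPreconnected S) (hd : ∀ t < k, Disjoint (segment ℝ (V t) (V (t + 1))) S)
    (hc : Disjoint (segment ℝ (V k) (V 0)) S) {x y : Plane} (hx : x ∈ S) (hy : y ∈ S) :
    windingAngle V k x = windingAngle V k y := by
  have hint : ∀ z ∈ S, ∃ m : ℤ, windingAngle V k z / (2 * Real.pi) = m := by
    intro z hz
    obtain ⟨m, hm⟩ := exists_windingAngle_eq (V := V) (k := k) (p := z) (by
      rintro t ht rfl
      rcases ht.lt_or_eq with ht | rfl
      · exact Set.disjoint_left.1 (hd t ht) (left_mem_segment ℝ _ _) hz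
      · exact Set.disjoint_left.1 hc (left_mem_segment ℝ _ _) hz)
    refine ⟨m, ?_⟩
    rw [hm]
    have := Real.pi_pos
    field_simp
  have hcont : ContinuousOn (fun z => windingAngle V k z / (2 * Real.pi)) S := by
    intro z hz
    refine ContinuousAt.continuousWithinAt (ContinuousAt.div_const (ContinuousAt.add ?_ ?_) _)
    · exact tendsto_finsetSum _ fun t ht => continuousAt_viewAngle
        (Set.disjoint_right.1 (hd t (Finset.mem_range.1 ht)) hz)
    · exact continuousAt_viewAngle (Set.disjoint_right.1 hc hz)
  have hsub := hS.image _ hcont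
  have hconst := hsub.subsingleton_of_forall_exists_intCast
    (by rintro _ ⟨z, hz, rfl⟩; exact hint z hz) (mem_image_of_mem _ hx) (mem_image_of_mem _ hy)
  exact (div_left_inj' Real.two_pi_pos.ne').1 hconst

lemma im_viewRatio (u w p : Plane) :
    ((Complex.equivRealProdCLM.symm w - Complex.equivRealProdCLM.symm p) /
      (Complex.equivRealProdCLM.symm u - Complex.equivRealProdCLM.symm p)).im =
    cross u w p / Complex.normSq
      (Complex.equivRealProdCLM.symm u - Complex.equivRealProdCLM.symm p) := by
  rw [Complex.div_im, ← sub_div]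
  congr 1
  simp [Complex.equivRealProdCLM_symm_apply, cross]
  ring

lemma cross_midpoint_add (a b u : Plane) (ε : ℝ) :
    cross a b ((1 / 2 : ℝ) • a + (1 / 2 : ℝ) • b +
      ε • (u - ((1 / 2 : ℝ) • a + (1 / 2 : ℝ) • b))) = ε * cross a b u := by
  simp only [cross, Prod.fst_add, Prod.snd_add, Prod.smul_fst, Prod.smul_snd, smul_eq_mul,
    Prod.fst_sub, Prod.snd_sub]
  ring

lemma midpoint_add_mem_openTriangle (a b u : Plane) {ε : ℝ} (h0 : 0 < ε) (h1 : ε < 1) :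
    (1 / 2 : ℝ) • a + (1 / 2 : ℝ) • b + ε • (u - ((1 / 2 : ℝ) • a + (1 / 2 : ℝ) • b)) ∈
      openTriangle a b u :=
  ⟨(1 - ε) / 2, (1 - ε) / 2, ε, by linarith, by linarith, h0, by ring, by module⟩

lemma tendsto_midpoint_add (a b u : Plane) :
    Tendsto (fun ε : ℝ => (1 / 2 : ℝ) • a + (1 / 2 : ℝ) • b +
      ε • (u - ((1 / 2 : ℝ) • a + (1 / 2 : ℝ) • b))) (𝓝[>] 0)
      (𝓝 ((1 / 2 : ℝ) • a + (1 / 2 : ℝ) • b)) := by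
  have : Continuous fun ε : ℝ => (1 / 2 : ℝ) • a + (1 / 2 : ℝ) • b +
      ε • (u - ((1 / 2 : ℝ) • a + (1 / 2 : ℝ) • b)) := by fun_prop
  simpa using (this.tendsto 0).mono_left nhdsWithin_le_nhds

lemma midpoint_ne_right {a b : Plane} (hab : a ≠ b) :
    (1 / 2 : ℝ) • a + (1 / 2 : ℝ) • b ≠ b := by
  intro h
  have hmem : (1 / 2 : ℝ) • a + (1 / 2 : ℝ) • b ∈ openSegment ℝ a b :=
    half_smul_add_half_smul_mem_openSegment a b
  rw [h] at hmem
  exact hab (right_mem_openSegment_iff.1 hmem)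

lemma viewRatio_midpoint {a b : Plane} (hab : a ≠ b) :
    (Complex.equivRealProdCLM.symm a -
      Complex.equivRealProdCLM.symm ((1 / 2 : ℝ) • a + (1 / 2 : ℝ) • b)) /
    (Complex.equivRealProdCLM.symm b -
      Complex.equivRealProdCLM.symm ((1 / 2 : ℝ) • a + (1 / 2 : ℝ) • b)) = -1 := by
  rw [div_eq_iff (viewRatio_ne_zero (midpoint_ne_right hab)), neg_one_mul, ← map_sub, ← map_sub,
    ← map_neg]
  congr 1
  module

/-- The angle of a segment jumps by `-π` when its midpoint is approached from the left. -/
lemma tendsto_viewAngle_of_cross_pos {a b u : Plane} (hab : a ≠ b) (hu : 0 < cross a b u) :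
    Tendsto (fun ε : ℝ => viewAngle b a ((1 / 2 : ℝ) • a + (1 / 2 : ℝ) • b +
      ε • (u - ((1 / 2 : ℝ) • a + (1 / 2 : ℝ) • b)))) (𝓝[>] 0) (𝓝 (-Real.pi)) := by
  refine (Complex.tendsto_arg_nhdsWithin_im_neg_of_re_neg_of_im_zero (z := -1) (by simp)
    (by simp)).comp (tendsto_nhdsWithin_iff.2 ⟨?_, ?_⟩)
  · rw [← viewRatio_midpoint hab]
    exact (continuousAt_viewRatio a (midpoint_ne_right hab)).tendsto.comp
      (tendsto_midpoint_add a b u)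
  · filter_upwards [self_mem_nhdsWithin,
      (tendsto_midpoint_add a b u).eventually_ne (midpoint_ne_right hab)] with ε hε hne
    have hε : 0 < ε := hε
    change Complex.im _ < 0
    rw [im_viewRatio, cross_swap, cross_midpoint_add]
    exact div_neg_of_neg_of_pos (neg_neg_of_pos (mul_pos hε hu))
      (Complex.normSq_pos.2 (viewRatio_ne_zero hne))

/-- The angle of a segment jumps by `π` when its midpoint is approached from the right. -/
lemma tendsto_viewAngle_of_cross_neg {a b u : Plane} (hab : a ≠ b) (hu : cross a b u < 0) :
    Tendsto (fun ε : ℝ => viewAngle b a ((1 / 2 : ℝ) • a + (1 / 2 : ℝ) • b +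
      ε • (u - ((1 / 2 : ℝ) • a + (1 / 2 : ℝ) • b)))) (𝓝[>] 0) (𝓝 Real.pi) := by
  refine (Complex.tendsto_arg_nhdsWithin_im_nonneg_of_re_neg_of_im_zero (z := -1) (by simp)
    (by simp)).comp (tendsto_nhdsWithin_iff.2 ⟨?_, ?_⟩)
  · rw [← viewRatio_midpoint hab]
    exact (continuousAt_viewRatio a (midpoint_ne_right hab)).tendsto.comp
      (tendsto_midpoint_add a b u)
  · filter_upwards [self_mem_nhdsWithin] with ε hε
    have hε : 0 < ε := hε
    change 0 ≤ Complex.im _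
    rw [im_viewRatio, cross_swap, cross_midpoint_add]
    exact div_nonneg (neg_nonneg.2 (mul_nonpos_of_nonneg_of_nonpos hε.le hu.le))
      (Complex.normSq_nonneg _)

/-- The total angle is the same at the apex and near the base of a triangle over the closing
segment that avoids the rest of the polygonal line. -/
lemma eventually_windingAngle_eq {V : ℕ → Plane} {k : ℕ} {u : Plane}
    (hu : cross (V 0) (V k) u ≠ 0)
    (hT : ∀ t < k, Disjoint (segment ℝ (V t) (V (t + 1))) (openTriangle (V 0) (V k) u))
    (hut : ∀ t < k, u ∉ segment ℝ (V t) (V (t + 1))) :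
    ∀ᶠ ε : ℝ in 𝓝[>] 0, windingAngle V k ((1 / 2 : ℝ) • V 0 + (1 / 2 : ℝ) • V k +
      ε • (u - ((1 / 2 : ℝ) • V 0 + (1 / 2 : ℝ) • V k))) = windingAngle V k u := by
  have hle : ∀ᶠ t : ℝ in 𝓝[>] 0, t < 1 := nhdsWithin_le_nhds (Iio_mem_nhds zero_lt_one)
  filter_upwards [hle, self_mem_nhdsWithin] with ε h1 h0
  have hclos : u ∈ closure (openTriangle (V 0) (V k) u) := by
    simpa using mem_closure_openTriangle (V 0) (V k) u le_rfl le_rfl zero_le_one (by norm_num)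
  have hS : IsPreconnected (insert u (openTriangle (V 0) (V k) u)) :=
    (convex_openTriangle _ _ _).isPreconnected.subset_closure (Set.subset_insert _ _)
      (Set.insert_subset hclos subset_closure)
  refine windingAngle_eq_of_isPreconnected hS (fun t ht => ?_) ?_
    (Or.inr (midpoint_add_mem_openTriangle _ _ _ h0 h1)) (Or.inl rfl)
  · exact Set.disjoint_insert_right.2 ⟨hut t ht, hT t ht⟩
  · rw [segment_symm, Set.disjoint_left]
    intro x hx hx'
    have hx0 := cross_eq_zero_of_mem_segment hx
    rcases hx' with rfl | ⟨α, β, γ, hα, hβ, hγ, h, rfl⟩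
    · exact hu hx0
    · rw [cross_combination _ _ _ h] at hx0
      exact mul_ne_zero hγ.ne' hu hx0

/-- The total angle of a closed polygonal line differs on the two sides of its closing segment. -/
lemma windingAngle_ne_of_opposite_sides {V : ℕ → Plane} {k : ℕ} {u w : Plane} (hab : V 0 ≠ V k)
    (hq : ∀ t < k, (1 / 2 : ℝ) • V 0 + (1 / 2 : ℝ) • V k ∉ segment ℝ (V t) (V (t + 1)))
    (hu : 0 < cross (V 0) (V k) u) (hw : cross (V 0) (V k) w < 0)
    (hTu : ∀ t < k, Disjoint (segment ℝ (V t) (V (t + 1))) (openTriangle (V 0) (V k) u))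
    (hTw : ∀ t < k, Disjoint (segment ℝ (V t) (V (t + 1))) (openTriangle (V 0) (V k) w))
    (hut : ∀ t < k, u ∉ segment ℝ (V t) (V (t + 1)))
    (hwt : ∀ t < k, w ∉ segment ℝ (V t) (V (t + 1))) :
    windingAngle V k u ≠ windingAngle V k w := by
  have hsum : ContinuousAt (fun p => ∑ t ∈ Finset.range k, viewAngle (V t) (V (t + 1)) p)
      ((1 / 2 : ℝ) • V 0 + (1 / 2 : ℝ) • V k) :=
    tendsto_finsetSum _ fun t ht => continuousAt_viewAngle (hq t (Finset.mem_range.1 ht))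
  have h1 := tendsto_nhds_unique
    (((hsum.tendsto.comp (tendsto_midpoint_add _ _ u)).add
      (tendsto_viewAngle_of_cross_pos hab hu)))
    (tendsto_const_nhds.congr' ((eventually_windingAngle_eq hu.ne' hTu hut).mono
      fun _ h => h.symm))
  have h2 := tendsto_nhds_unique
    (((hsum.tendsto.comp (tendsto_midpoint_add _ _ w)).add
      (tendsto_viewAngle_of_cross_neg hab hw)))
    (tendsto_const_nhds.congr' ((eventually_windingAngle_eq hw.ne hTw hwt).mono
      fun _ h => h.symm))
  intro h
  linarith [Real.pi_pos]

namespace SimplePolygon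

lemma natCast_injOn {n s t : ℕ} (hs : s < n) (ht : t < n) (h : (s : ZMod n) = t) : s = t := by
  rw [ZMod.natCast_eq_natCast_iff', Nat.mod_eq_of_lt hs, Nat.mod_eq_of_lt ht] at h
  exact h

/-- Two vertices of the complementary chain cannot both see the base of the chain along a free
triangle, from different sides. -/
lemma not_both_sides {n : ℕ} (SP : SimplePolygon n) {i : ZMod n} {k : ℕ} (hk : 2 ≤ k)
    (hd : ∀ m, Disjoint (SP.edge m) (openSegment ℝ (SP.v i) (SP.v (i + (k : ZMod n)))))
    {s t : ℕ} (hks : k < s) (hsn : s < n) (hkt : k < t) (htn : t < n)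
    (hs : 0 < cross (SP.v i) (SP.v (i + (k : ZMod n))) (SP.v (i + (s : ZMod n))))
    (ht : cross (SP.v i) (SP.v (i + (k : ZMod n))) (SP.v (i + (t : ZMod n))) < 0)
    (hTs : openTriangle (SP.v i) (SP.v (i + (k : ZMod n))) (SP.v (i + (s : ZMod n))) ⊆
      interior SP.P)
    (hTt : openTriangle (SP.v i) (SP.v (i + (k : ZMod n))) (SP.v (i + (t : ZMod n))) ⊆
      interior SP.P) : False := by
  have hind : ∀ {x y : ℕ}, x < n → y < n → x ≠ y → i + (x : ZMod n) ≠ i + (y : ZMod n) :=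
    fun hx hy hxy h => hxy (natCast_injOn hx hy (add_left_cancel h))
  set V : ℕ → Plane := fun x => SP.v (i + (x : ZMod n)) with hV
  have hV0 : V 0 = SP.v i := by simp [hV]
  have hVk : V k = SP.v (i + (k : ZMod n)) := rfl
  have hVs : ∀ x, segment ℝ (V x) (V (x + 1)) = SP.edge (i + (x : ZMod n)) := by
    intro x
    simp only [hV, edge, Nat.cast_add, Nat.cast_one, add_assoc]
  have hVinj : ∀ {x y : ℕ}, x < n → y < n → x ≠ y → V x ≠ V y := fun hx hy hxy h =>
    hind hx hy hxy (SP.inj h)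
  have hmem : ∀ {x y z : ℕ}, x < n → y < n → z < n → x ≠ y → x ≠ z → y ≠ z →
      V x ∉ segment ℝ (V y) (V z) := by
    intro x y z hx hy hz hxy hxz hyz h
    rcases SP.eq_or_eq_of_mem_segment (hind hy hz hyz) h with h | h
    · exact hind hx hy hxy h
    · exact hind hx hz hxz h
  rw [← hVk, ← hV0] at hd hs ht hTs hTt
  have hstep : ∀ l, k < l → l + 1 < n → windingAngle V k (V l) = windingAngle V k (V (l + 1)) := by
    intro l hkl hln
    refine windingAngle_eq_of_isPreconnected (convex_segment (V l) (V (l + 1))).isPreconnected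
      (fun x hx => ?_) ?_ (left_mem_segment ℝ _ _) (right_mem_segment ℝ _ _)
    · rw [hVs, hVs]
      refine SP.edges_disjoint _ _ (hind (by omega) (by omega) (by omega)) ?_ ?_
      · have := hind (x := l) (y := x + 1) (by omega) (by omega) (by omega)
        rwa [Nat.cast_add, Nat.cast_one, ← add_assoc] at this
      · have := hind (x := x) (y := l + 1) (by omega) (by omega) (by omega)
        rwa [Nat.cast_add, Nat.cast_one, ← add_assoc] at this
    · rw [segment_symm, Set.disjoint_left]
      intro x hx hx'
      rw [← insert_endpoints_openSegment] at hx
      rcases hx with rfl | rfl | hx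
      · exact hmem (by omega) (by omega) hln (by omega) (by omega) (by omega) hx'
      · exact hmem (by omega) (by omega) hln (by omega) (by omega) (by omega) hx'
      · rw [hVs] at hx'
        exact Set.disjoint_left.1 (hd _) hx' hx
  have hall : ∀ l, k + 1 ≤ l → l < n → windingAngle V k (V (k + 1)) = windingAngle V k (V l) := by
    intro l hl
    induction l, hl using Nat.le_induction with
    | base => exact fun _ => rfl
    | succ l hl ih => exact fun h => (ih (by omega)).trans (hstep l hl h)
  have hdis : ∀ {S : Set Plane}, S ⊆ interior SP.P → ∀ x < k,
      Disjoint (segment ℝ (V x) (V (x + 1))) S := by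
    intro S hS x hx
    rw [hVs]
    exact SP.disjoint_edge_of_subset_interior _ hS
  refine windingAngle_ne_of_opposite_sides (V := V) (k := k)
    (hVinj (by omega) (by omega) (by omega)) (fun x hx h => ?_) hs ht (hdis hTs) (hdis hTt)
    (fun x hx => hmem hsn (by omega) (by omega) (by omega) (by omega) (by omega))
    (fun x hx => hmem htn (by omega) (by omega) (by omega) (by omega) (by omega))
    ((hall s hks hsn).symm.trans (hall t hkt htn))
  rw [hVs] at h
  exact Set.disjoint_left.1 (hd _) h (half_smul_add_half_smul_mem_openSegment _ _)

lemma visible_of_openTriangle_subset {n : ℕ} (SP : SimplePolygon n) {a b p : Plane}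
    (h : openTriangle a b p ⊆ interior SP.P) : Visible SP.P p a ∧ Visible SP.P p b := by
  have hsub : closure (openTriangle a b p) ⊆ SP.P :=
    closure_minimal (h.trans interior_subset) SP.isClosed
  constructor <;> rintro _ ⟨s, t, hs, ht, hst, rfl⟩ <;> apply hsub
  · have := mem_closure_openTriangle a b p ht le_rfl hs (by linarith)
    rwa [zero_smul, add_zero, add_comm] at this
  · have := mem_closure_openTriangle a b p le_rfl ht hs (by linarith)
    rwa [zero_smul, zero_add, add_comm] at this

/-- A version of `exists_vertex_of_frequently` for the right side of the base. -/
lemma exists_vertex_of_frequently_neg {n : ℕ} (SP : SimplePolygon n) {i j : ZMod n}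
    (hij : i ≠ j) (hfree : SP.IsFree i j) {q : Plane}
    (hq : q ∈ openSegment ℝ (SP.v i) (SP.v j))
    (hfreq : ∃ᶠ x in 𝓝 q, x ∈ interior SP.P ∧ cross (SP.v i) (SP.v j) x < 0) :
    ∃ r, cross (SP.v i) (SP.v j) (SP.v r) < 0 ∧
      openTriangle (SP.v i) (SP.v j) (SP.v r) ⊆ interior SP.P := by
  obtain ⟨r, hr, hT⟩ := SP.exists_vertex_of_frequently hij.symm hfree.symm
    (by rwa [openSegment_symm]) (hfreq.mono fun x hx => ⟨hx.1, by
      rw [cross_swap]; exact neg_pos.2 hx.2⟩)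
  rw [cross_swap] at hr
  rw [openTriangle_swap] at hT
  exact ⟨r, neg_pos.1 hr, hT⟩

lemma exists_eq_add_natCast {n : ℕ} (SP : SimplePolygon n) (i : ZMod n) (k : ℕ) {r : ZMod n}
    (h : cross (SP.v i) (SP.v (i + (k : ZMod n))) (SP.v r) ≠ 0) :
    ∃ s : ℕ, 1 ≤ s ∧ s < n ∧ s ≠ k ∧ r = i + (s : ZMod n) := by
  have : NeZero n := ⟨by have := SP.three_le; omega⟩
  have hr : r = i + ((r - i).val : ZMod n) := by rw [ZMod.natCast_zmod_val]; abel
  refine ⟨(r - i).val, Nat.one_le_iff_ne_zero.2 fun h0 => h ?_, ZMod.val_lt _, ?_, hr⟩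
  · rw [h0, Nat.cast_zero, add_zero] at hr
    rw [hr]
    exact cross_eq_zero_of_mem_segment (left_mem_segment ℝ _ _)
  · rintro h0
    rw [h0] at hr
    rw [hr] at h
    exact h (cross_eq_zero_of_mem_segment (right_mem_segment ℝ _ _))

/-- Some vertex of the chain spans a free triangle over the diagonal. -/
lemma exists_chain_vertex_openTriangle_subset {n : ℕ} (SP : SimplePolygon n) (i : ZMod n) {k : ℕ}
    (hk2 : 2 ≤ k) (hkn : k ≤ n - 1) (hvis : Visible SP.P (SP.v i) (SP.v (i + (k : ZMod n)))) :
    ∃ t : ℕ, 1 ≤ t ∧ t ≤ k - 1 ∧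
      openTriangle (SP.v i) (SP.v (i + (k : ZMod n))) (SP.v (i + (t : ZMod n))) ⊆
        interior SP.P := by
  have h3 := SP.three_le
  have hij : i ≠ i + (k : ZMod n) := by
    intro h
    have := natCast_injOn (n := n) (s := 0) (t := k) (by omega) (by omega)
      (by rw [Nat.cast_zero]; exact left_eq_add.1 h |>.symm)
    omega
  have hab : SP.v i ≠ SP.v (i + (k : ZMod n)) := fun h => hij (SP.inj h)
  have hq := half_smul_add_half_smul_mem_openSegment (SP.v i) (SP.v (i + (k : ZMod n)))
  set q := (1 / 2 : ℝ) • SP.v i + (1 / 2 : ℝ) • SP.v (i + (k : ZMod n))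
  have hqP : q ∈ SP.P := hvis (openSegment_subset_segment ℝ _ _ hq)
  rcases hkn.eq_or_lt with hkn | hkn
  · have hfree : SP.IsFree i (i + (k : ZMod n)) := by
      refine SP.isFree_of_add_one_eq ?_
      have : (k : ZMod n) + 1 = 0 := by
        rw [← Nat.cast_one, ← Nat.cast_add, show k + 1 = n by omega, ZMod.natCast_self]
      rw [add_assoc, this, add_zero]
    obtain ⟨r, hr, hT⟩ : ∃ r, cross (SP.v i) (SP.v (i + (k : ZMod n))) (SP.v r) ≠ 0 ∧
        openTriangle (SP.v i) (SP.v (i + (k : ZMod n))) (SP.v r) ⊆ interior SP.P := by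
      have hfreq := frequently_cross_ne_zero hab isOpen_interior (SP.regular ▸ hqP)
      simp only [ne_iff_lt_or_gt, and_or_left, frequently_or_distrib] at hfreq
      rcases hfreq with h | h
      · obtain ⟨r, hr, hT⟩ := SP.exists_vertex_of_frequently_neg hij hfree hq h
        exact ⟨r, hr.ne, hT⟩
      · obtain ⟨r, hr, hT⟩ := SP.exists_vertex_of_frequently hij hfree hq h
        exact ⟨r, hr.ne', hT⟩
    obtain ⟨s, hs1, hsn, hsk, rfl⟩ := SP.exists_eq_add_natCast i k hr
    exact ⟨s, hs1, by omega, hT⟩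
  · have hd := SP.disjoint_edge_of_visible hij (fun h => ?_) (fun h => ?_) hvis
    rotate_left
    · have := natCast_injOn (n := n) (s := k) (t := 1) (by omega) (by omega)
        (by rw [Nat.cast_one]; exact add_left_cancel h)
      omega
    · have := natCast_injOn (n := n) (s := k + 1) (t := 0) (by omega) (by omega)
        (by rw [Nat.cast_add, Nat.cast_one, Nat.cast_zero]; rw [add_assoc] at h
            exact (left_eq_add.1 h))
      omega
    have hfree : SP.IsFree i (i + (k : ZMod n)) := fun m => Or.inl (hd m)
    have hqi : q ∈ interior SP.P := by
      by_contra hni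
      have hqf : q ∈ frontier SP.P := SP.isClosed.frontier_eq ▸ ⟨hqP, hni⟩
      obtain ⟨m, hm⟩ := SP.exists_mem_edge hqf
      exact Set.disjoint_left.1 (hd m) hm hq
    have hU := isOpen_interior.mem_nhds hqi
    have hq0 : cross (SP.v i) (SP.v (i + (k : ZMod n))) q = 0 :=
      cross_eq_zero_of_mem_segment (openSegment_subset_segment ℝ _ _ hq)
    obtain ⟨r, hr, hTr⟩ := SP.exists_vertex_of_frequently hij hfree hq
      (frequently_cross_pos hab hU hq0)
    obtain ⟨r', hr', hTr'⟩ := SP.exists_vertex_of_frequently_neg hij hfree hq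
      ((frequently_cross_pos hab.symm hU (by rw [cross_swap, hq0, neg_zero])).mono fun x hx =>
        ⟨hx.1, by have := hx.2; rw [cross_swap] at this; exact neg_pos.1 this⟩)
    obtain ⟨s, hs1, hsn, hsk, rfl⟩ := SP.exists_eq_add_natCast i k hr.ne'
    obtain ⟨t, ht1, htn, htk, rfl⟩ := SP.exists_eq_add_natCast i k hr'.ne
    rcases hsk.lt_or_gt with hsk | hsk
    · exact ⟨s, hs1, by omega, hTr⟩
    rcases htk.lt_or_gt with htk | htk
    · exact ⟨t, ht1, by omega, hTr'⟩
    exact (SP.not_both_sides hk2 hd hsk hsn htk htn hr hr' hTr hTr').elim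

end SimplePolygon

/-- Let `j = i + k` with `2 ≤ k ≤ n - 1`. If `v i` is visible to `v j`, then some vertex
`v (i+t)` of the chain `ch(v (i+1), v (j-1))`, i.e. with `1 ≤ t ≤ k - 1`, is visible to
both `v i` and `v j`. -/
theorem exists_chain_vertex_visible_to_both {n : ℕ} (SP : SimplePolygon n)
    (i : ZMod n) (k : ℕ) (hk2 : 2 ≤ k) (hkn : k ≤ n - 1)
    (hij : Visible SP.P (SP.v i) (SP.v (i + (k : ZMod n)))) :
    ∃ t : ℕ, 1 ≤ t ∧ t ≤ k - 1 ∧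
      Visible SP.P (SP.v (i + (t : ZMod n))) (SP.v i) ∧
      Visible SP.P (SP.v (i + (t : ZMod n))) (SP.v (i + (k : ZMod n))) := by
  obtain ⟨t, h1, h2, hT⟩ := SP.exists_chain_vertex_openTriangle_subset i hk2 hkn hij
  exact ⟨t, h1, h2, SP.visible_of_openTriangle_subset hT⟩
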